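/- arXiv:1103.6069 — 4 statements merged into one kernel-verified Lean document; each statement's English description precedes it below -/
import Mathlib

section
/- Let G be a finite permutation group with point stabiliser H, let p be a prime, and let S be a Sylow p-subgroup of H. If the number of G-conjugates of S exceeds m² − m + 1, where m is the number of H-conjugates of S, then G has a subdegree divisible by p. -/
/-- The conjugate subgroup `H^g = g⁻¹ H g`. -/
def conjSubgroup {G : Type*} [Group G] (g : G) (H : Subgroup G) : Subgroup G :=
  H.map (MulAut.conj g⁻¹).toMonoidHom

/-- `S` is a Sylow `p`-subgroup of the subgroup `H` of `G`. -/
def IsSylowIn {G : Type*} [Group G] (p : ℕ) (S H : Subgroup G) : Prop :=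
  S ≤ H ∧ IsPGroup p S ∧ ∀ Q : Subgroup G, Q ≤ H → IsPGroup p Q → S ≤ Q → Q = S

open scoped Pointwise

/-- The indicator function of the translate `g • Γ`. -/
noncomputable def translateIndicator {G X : Type*} [Group G] [MulAction G X] (Γ : Set X) (g : G) :
    X → ℝ :=
  (g • Γ).indicator 1

theorem sum_translateIndicator {G X : Type*} [Group G] [Fintype X] [MulAction G X]
    (Γ : Set X) (g : G) : ∑ x, translateIndicator Γ g x = Nat.card Γ := by
  classical
  simp only [translateIndicator, Set.indicator_apply, Pi.one_apply]
  rw [Finset.sum_boole, ← Set.natCard_smul_set g Γ]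
  simp only [Nat.card_eq_fintype_card]
  rw [Fintype.card_subtype]

theorem translateIndicator_mul_self {G X : Type*} [Group G] [MulAction G X]
    (Γ : Set X) (g : G) (x : X) :
    translateIndicator Γ g x * translateIndicator Γ g x = translateIndicator Γ g x := by
  classical
  simp [translateIndicator, Set.indicator_apply]

/-- If no translate of `Γ` is disjoint from `Γ`, any two translates share a point. -/
theorem one_le_sum_translateIndicator_mul {G X : Type*} [Group G] [Fintype X] [MulAction G X]
    {Γ : Set X} (hΓ : ∀ g : G, ∃ x ∈ Γ, g • x ∈ Γ) (g h : G) :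
    1 ≤ ∑ x, translateIndicator Γ g x * translateIndicator Γ h x := by
  classical
  obtain ⟨x, hx, hx'⟩ := hΓ (h⁻¹ * g)
  have h1 : translateIndicator Γ g (g • x) = 1 := by
    simp [translateIndicator, hx]
  have h2 : translateIndicator Γ h (g • x) = 1 := by
    have : g • x = h • ((h⁻¹ * g) • x) := by simp [mul_smul]
    rw [this]
    simp only [translateIndicator, Set.indicator_apply, Set.smul_mem_smul_set_iff, hx', if_true,
      Pi.one_apply]
  calc (1 : ℝ) = translateIndicator Γ g (g • x) * translateIndicator Γ h (g • x) := by
        rw [h1, h2, one_mul]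
    _ ≤ _ := Finset.single_le_sum
        (f := fun x => translateIndicator Γ g x * translateIndicator Γ h x)
        (fun y _ => mul_nonneg (Set.indicator_nonneg (by simp) _)
          (Set.indicator_nonneg (by simp) _)) (Finset.mem_univ _)

/-- In a transitive action, the average of the translates of `Γ` is constant. -/
theorem const_mem_convexHull_translateIndicator {G X : Type*} [Group G] [Finite G] [Fintype X]
    [MulAction G X] [MulAction.IsPretransitive G X] (Γ : Set X) :
    (fun _ : X => (Nat.card Γ / Fintype.card X : ℝ)) ∈
      convexHull ℝ (Set.range (translateIndicator (G := G) Γ)) := by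
  classical
  have := Fintype.ofFinite G
  set a : X → ℝ := ∑ g : G, (Fintype.card G : ℝ)⁻¹ • translateIndicator Γ g with ha
  have hmem : a ∈ convexHull ℝ (Set.range (translateIndicator (G := G) Γ)) := by
    refine (convex_convexHull ℝ _).sum_mem (fun _ _ => by positivity) ?_
      (fun g _ => subset_convexHull ℝ _ ⟨g, rfl⟩)
    simp
  have hsum : ∑ x, a x = Nat.card Γ := by
    simp only [ha, Finset.sum_apply, Pi.smul_apply, smul_eq_mul]
    rw [Finset.sum_comm]
    simp_rw [← Finset.mul_sum, sum_translateIndicator]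
    simp
  have hinv : ∀ (g : G) (x : X), a (g • x) = a x := by
    intro g x
    simp only [ha, Finset.sum_apply]
    refine (Fintype.sum_equiv (Equiv.mulLeft g) _ _ fun h => ?_).symm
    have : translateIndicator Γ (g * h) (g • x) = translateIndicator Γ h x := by
      simp only [translateIndicator, Set.indicator_apply, mul_smul, Set.smul_mem_smul_set_iff,
        Pi.one_apply]
    simp [this]
  convert hmem using 1
  ext x
  have hconst : ∀ y, a y = a x := fun y => by
    obtain ⟨g, rfl⟩ := MulAction.exists_smul_eq G x y
    exact hinv g x
  rw [← hsum, Finset.sum_congr rfl fun y _ => hconst y]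
  have : (Fintype.card X : ℝ) ≠ 0 := by
    have : Nonempty X := ⟨x⟩
    exact_mod_cast Fintype.card_ne_zero
  simp [this]

/-- **Neumann–Praeger** for transitive actions: if no translate of the set `Γ` is
disjoint from `Γ`, then the action has degree at most `k² - k + 1`, where `k = |Γ|`. -/
theorem card_add_card_le_of_forall_inter_smul_nonempty {G X : Type*} [Group G] [Finite G]
    [Finite X] [MulAction G X] [MulAction.IsPretransitive G X] (Γ : Set X)
    (hΓ : ∀ g : G, ∃ x ∈ Γ, g • x ∈ Γ) :
    Nat.card X + Nat.card Γ ≤ Nat.card Γ ^ 2 + 1 := by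
  classical
  have := Fintype.ofFinite X
  rw [Nat.card_eq_fintype_card (α := X)]
  set k := Nat.card Γ with hk
  set n := Fintype.card X with hn
  obtain ⟨x₀, hx₀, -⟩ := hΓ 1
  have hk1 : 1 ≤ k := by
    have : Nonempty Γ := ⟨⟨x₀, hx₀⟩⟩
    exact Nat.card_pos
  have hn1 : 1 ≤ n := Fintype.card_pos_iff.mpr ⟨x₀⟩
  obtain ⟨ι, _, z, w, hz, hind, hw, hw1, hwz⟩ :=
    eq_pos_convex_span_of_mem_convexHull (const_mem_convexHull_translateIndicator (G := G) Γ)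
  have hcard : Fintype.card ι ≤ n + 1 := by
    refine hind.card_le_finrank_succ.trans ?_
    gcongr
    exact (Submodule.finrank_le _).trans (by simp [hn])
  choose g hg using fun i => hz ⟨i, rfl⟩
  obtain ⟨i, hi⟩ : ∃ i, 1 ≤ (n + 1 : ℝ) * w i := by
    by_contra! hcon
    have : Nonempty ι := by
      by_contra hne
      have := not_nonempty_iff.mp hne
      simp at hw1
    have h1 : ∑ i, (n + 1 : ℝ) * w i < ∑ _i : ι, (1 : ℝ) :=
      Finset.sum_lt_sum_of_nonempty Finset.univ_nonempty fun i _ => hcon i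
    rw [← Finset.mul_sum, hw1] at h1
    have h2 : (Fintype.card ι : ℝ) ≤ n + 1 := by exact_mod_cast hcard
    simp at h1
    linarith
  have hdiag : ∑ x, z i x * z i x = k := by
    simp_rw [← hg, translateIndicator_mul_self]
    exact sum_translateIndicator Γ _
  have htotal : ∑ j, w j * ∑ x, z i x * z j x = (k : ℝ) ^ 2 / n := by
    calc ∑ j, w j * ∑ x, z i x * z j x = ∑ x, z i x * (∑ j, w j • z j) x := by
          simp_rw [Finset.sum_apply, Finset.mul_sum]
          rw [Finset.sum_comm]
          refine Finset.sum_congr rfl fun x _ => Finset.sum_congr rfl fun j _ => ?_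
          simp only [Pi.smul_apply, smul_eq_mul]
          ring
      _ = (k : ℝ) ^ 2 / n := by
          rw [hwz, ← Finset.sum_mul, ← hg, sum_translateIndicator]
          ring
  have hlower : 1 + (k - 1) * w i ≤ (k : ℝ) ^ 2 / n := by
    have h1 : ∑ j, w j * (1 + if j = i then (k - 1 : ℝ) else 0) ≤
        ∑ j, w j * ∑ x, z i x * z j x := by
      refine Finset.sum_le_sum fun j _ => mul_le_mul_of_nonneg_left ?_ (hw j).le
      split_ifs with hji
      · rw [hji, hdiag]
        linarith
      · rw [add_zero, ← hg, ← hg]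
        exact one_le_sum_translateIndicator_mul hΓ _ _
    rw [htotal] at h1
    simp only [mul_add, Finset.sum_add_distrib, mul_one, hw1, mul_ite, mul_zero,
      Finset.sum_ite_eq', Finset.mem_univ, if_true] at h1
    linarith
  have hkR : (1 : ℝ) ≤ k := by exact_mod_cast hk1
  have hnR : (1 : ℝ) ≤ n := by exact_mod_cast hn1
  have hmain : (n : ℝ) * (n + k) ≤ k ^ 2 * (n + 1) := by
    rw [le_div_iff₀ (by linarith)] at hlower
    have h1 : (k - 1 : ℝ) ≤ (k - 1) * ((n + 1) * w i) :=
      le_mul_of_one_le_right (by linarith) hi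
    have h2 := mul_le_mul_of_nonneg_right hlower (by linarith : (0 : ℝ) ≤ n + 1)
    nlinarith
  by_contra! hcon
  have hconR : (k : ℝ) ^ 2 + 2 ≤ n + k := by exact_mod_cast hcon
  nlinarith [sq_nonneg ((k : ℝ) - 1), mul_le_mul_of_nonneg_left hconR (by linarith : (0 : ℝ) ≤ n)]

theorem conjSubgroup_eq_smul {G : Type*} [Group G] (g : G) (H : Subgroup G) :
    conjSubgroup g H = ConjAct.toConjAct g⁻¹ • H := by
  ext x
  simp [conjSubgroup, Subgroup.mem_map, Subgroup.mem_smul_pointwise_iff_exists, ConjAct.smul_def]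

theorem mem_conjSubgroup_iff {G : Type*} [Group G] {g : G} {H : Subgroup G} {x : G} :
    x ∈ conjSubgroup g H ↔ g * x * g⁻¹ ∈ H := by
  constructor
  · rintro ⟨y, hy, rfl⟩
    simpa [mul_assoc] using hy
  · exact fun h => ⟨_, h, by simp [mul_assoc]⟩

theorem natCard_conjSubgroup {G : Type*} [Group G] (g : G) (H : Subgroup G) :
    Nat.card (conjSubgroup g H) = Nat.card H :=
  Subgroup.card_map_of_injective (MulAut.conj g⁻¹).injective

/-- A Sylow subgroup of `H`, regarded as a subgroup of the ambient group, is Sylow in `H`. -/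
def IsSylowIn.toSylow {G : Type*} [Group G] {p : ℕ} {S H : Subgroup G} (hS : IsSylowIn p S H) :
    Sylow p H where
  toSubgroup := S.subgroupOf H
  isPGroup' := hS.2.1.comap_subtype
  is_maximal' {Q} hQ hle := by
    have hQS : Q.map H.subtype = S := by
      refine hS.2.2 _ (Subgroup.map_subtype_le Q) (hQ.map _) ?_
      rw [← Subgroup.map_subgroupOf_eq_of_le hS.1]
      exact Subgroup.map_mono hle
    rw [← hQS, Subgroup.subgroupOf, Subgroup.comap_map_eq_self_of_injective H.subtype_injective]

/-- A subgroup of `H` of the same order as a Sylow subgroup `S` of `H` is an `H`-conjugate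
of `S`. -/
theorem IsSylowIn.exists_eq_conjSubgroup {G : Type*} [Group G] [Finite G] {p : ℕ}
    (hp : p.Prime) {S H T : Subgroup G} (hS : IsSylowIn p S H) (hT : T ≤ H)
    (hcard : Nat.card T = Nat.card S) : ∃ h ∈ H, T = conjSubgroup h S := by
  have := Fact.mk hp
  have hTp : IsPGroup p (T.subgroupOf H) := by
    obtain ⟨n, hn⟩ := hS.2.1.exists_card_eq
    exact (IsPGroup.of_card (hcard.trans hn)).comap_subtype
  obtain ⟨Q, hQ⟩ := hTp.exists_le_sylow
  obtain ⟨h, rfl⟩ := MulAction.exists_smul_eq H hS.toSylow Q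
  refine ⟨h⁻¹, H.inv_mem h.2, Subgroup.eq_of_le_of_card_ge (fun x hx => ?_) ?_⟩
  · have hx' := hQ (show (⟨x, hT hx⟩ : H) ∈ T.subgroupOf H from hx)
    obtain ⟨y, hy, hyx⟩ := hx'
    have hy' : (y : G) ∈ S := hy
    have hyx' : (h : G) * y * (h : G)⁻¹ = x := congrArg Subtype.val hyx
    rw [mem_conjSubgroup_iff, ← hyx']
    simpa [mul_assoc] using hy'
  · rw [natCard_conjSubgroup, hcard]

/-- If `p` does not divide the subdegree of `β`, some `H`-conjugate of `S` fixes `β`. -/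
theorem exists_conjSubgroup_le_stabilizer {G Ω : Type*} [Group G] [Finite Ω] [MulAction G Ω]
    {p : ℕ} (hp : p.Prime) {S H : Subgroup G} (hS : S ≤ H) (hSp : IsPGroup p S) {β : Ω}
    (hβ : ¬ p ∣ Nat.card (MulAction.orbit H β)) :
    ∃ h ∈ H, conjSubgroup h S ≤ MulAction.stabilizer G β := by
  have := Fact.mk hp
  have hSp' : IsPGroup p (S.subgroupOf H) := hSp.comap_subtype
  obtain ⟨⟨_, h, rfl⟩, hfix⟩ :=
    hSp'.nonempty_fixed_point_of_prime_not_dvd_card (MulAction.orbit H β) hβ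
  refine ⟨h, h.2, fun x hx => ?_⟩
  rw [mem_conjSubgroup_iff] at hx
  have h1 := congrArg Subtype.val (hfix ⟨⟨_, hS hx⟩, hx⟩)
  have h2 : ((h : G) * x * (h : G)⁻¹) • (h : G) • β = (h : G) • β := h1
  rw [mul_smul, inv_smul_smul, mul_smul] at h2
  exact MulAction.injective _ h2

/-- Lemma 2.5(i): if the number of `G`-conjugates of a Sylow `p`-subgroup `S` of the
point stabiliser `H` exceeds `m² − m + 1`, where `m` is the number of `H`-conjugates
of `S`, then `G` has a subdegree divisible by `p`. -/
theorem stmt5 {G Ω : Type*} [Group G] [Finite G] [Finite Ω] [MulAction G Ω]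
    [FaithfulSMul G Ω] (α : Ω) (p : ℕ) (hp : p.Prime) (S : Subgroup G)
    (hSyl : IsSylowIn p S (MulAction.stabilizer G α))
    (hbig : Nat.card {K : Subgroup G | ∃ g : G, K = conjSubgroup g S} >
      (Nat.card {K : Subgroup G | ∃ h ∈ MulAction.stabilizer G α, K = conjSubgroup h S}) ^ 2
        - Nat.card {K : Subgroup G | ∃ h ∈ MulAction.stabilizer G α, K = conjSubgroup h S}
        + 1) :
    ∃ β : Ω, p ∣ Nat.card (MulAction.orbit (MulAction.stabilizer G α) β) := by
  by_contra! hcon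
  set H := MulAction.stabilizer G α with hH
  let X := MulAction.orbit (ConjAct G) S
  let Γ : Set X := {K | ∃ h ∈ H, (K : Subgroup G) = conjSubgroup h S}
  have hmemX (g : G) : conjSubgroup g S ∈ MulAction.orbit (ConjAct G) S := by
    rw [conjSubgroup_eq_smul]
    exact MulAction.mem_orbit _ _
  have hX : {K : Subgroup G | ∃ g : G, K = conjSubgroup g S} = MulAction.orbit (ConjAct G) S := by
    ext K
    constructor
    · rintro ⟨g, rfl⟩
      exact hmemX g
    · rintro ⟨g, rfl⟩
      exact ⟨(ConjAct.ofConjAct g)⁻¹, by simp [conjSubgroup_eq_smul]⟩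
  have hΓcard : Nat.card {K : Subgroup G | ∃ h ∈ H, K = conjSubgroup h S} = Nat.card Γ := by
    rw [← Nat.card_image_of_injective Subtype.val_injective Γ]
    congr 2
    ext K
    constructor
    · rintro ⟨h, hh, rfl⟩
      exact ⟨⟨_, hmemX h⟩, ⟨h, hh, rfl⟩, rfl⟩
    · rintro ⟨K, hK, rfl⟩
      exact hK
  have hΓ (c : ConjAct G) : ∃ K ∈ Γ, c • K ∈ Γ := by
    set g := (ConjAct.ofConjAct c)⁻¹ with hg
    obtain ⟨h, hh, hle⟩ := exists_conjSubgroup_le_stabilizer hp hSyl.1 hSyl.2.1 (hcon (g • α))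
    have hconj : conjSubgroup g (conjSubgroup h S) ≤ H := fun x hx => by
      rw [mem_conjSubgroup_iff] at hx
      have h1 : (g * x * g⁻¹) • g • α = g • α := hle hx
      rw [mul_smul, inv_smul_smul, mul_smul] at h1
      exact MulAction.injective _ h1
    obtain ⟨h', hh', heq⟩ := hSyl.exists_eq_conjSubgroup hp hconj
      (by rw [natCard_conjSubgroup, natCard_conjSubgroup])
    refine ⟨⟨_, hmemX h⟩, ⟨h, hh, rfl⟩, h', hh', ?_⟩
    rw [← heq, conjSubgroup_eq_smul g]
    simp only [hg, inv_inv, ConjAct.toConjAct_ofConjAct]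
    rfl
  have : Finite (ConjAct G) := ‹Finite G›
  have hle := card_add_card_le_of_forall_inter_smul_nonempty Γ hΓ
  rw [hX, hΓcard] at hbig
  change Nat.card X > _ at hbig
  have := Nat.le_self_pow two_ne_zero (Nat.card Γ)
  omega
end

section
/- Let G be a finite permutation group with point stabiliser H, let p be a prime, and let x ∈ H have order a power of p, x ≠ 1. If |x^G| > |x^G ∩ H|² − |x^G ∩ H| + 1, then G has a subdegree divisible by p. -/
open Finset in
/-- A uniform regular pairwise intersecting family of `m`-sets on a ground set of `N` points
satisfies `N ≤ m² - m + 1`. -/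
theorem card_add_le_of_regular_intersecting {C ι : Type*} [Fintype C] [DecidableEq C]
    [Fintype ι] [Nonempty ι] (B : ι → Finset C) {m k : ℕ} (hm : 0 < m)
    (hcard : ∀ i, #(B i) = m) (hint : ∀ i j, (B i ∩ B j).Nonempty)
    (hreg : ∀ e, #{i | e ∈ B i} = k) :
    Fintype.card C + m ≤ m ^ 2 + 1 := by
  classical
  let v : ι → C → ℝ := fun i e => if e ∈ B i then 1 else 0
  have hv_sum (i : ι) : ∑ e, v i e = m := by simp [v, hcard]
  have hv_inter (i j : ι) : ∑ e, v i e * v j e = #(B i ∩ B j) := by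
    simp [v, ← ite_and, ← mem_inter, inter_comm]
  let q : C → ℝ := fun _ => k / Fintype.card ι
  have hq : q ∈ convexHull ℝ (Set.range v) := by
    have key : ∑ i : ι, (Fintype.card ι : ℝ)⁻¹ • v i ∈ convexHull ℝ (Set.range v) :=
      (convex_convexHull ℝ _).sum_mem (fun _ _ => by positivity) (by simp)
        fun i _ => subset_convexHull ℝ _ ⟨i, rfl⟩
    convert key using 1
    ext e
    simp [q, v, ← hreg e, div_eq_inv_mul, ← sum_filter, mul_comm]
  obtain ⟨J, _, z, w, hz, hind, hw, hw1, hwq⟩ := eq_pos_convex_span_of_mem_convexHull hq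
  choose f hf using fun j => hz ⟨j, rfl⟩
  obtain rfl : (fun j => v (f j)) = z := funext hf
  have hm0 : (0 : ℝ) < m := by exact_mod_cast hm
  have hlin : LinearIndependent ℝ fun j => v (f j) := by
    rw [Fintype.linearIndependent_iff]
    intro c hc
    have hc0 : ∑ j, c j = 0 := by
      have h : ∑ e, (∑ j, c j • v (f j)) e = 0 := by
        rw [hc]
        simp
      simp only [Finset.sum_apply, Pi.smul_apply, smul_eq_mul] at h
      rw [sum_comm] at h
      simp only [← mul_sum, hv_sum, ← sum_mul] at h
      exact (mul_eq_zero.mp h).resolve_right hm0.ne'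
    intro j
    exact (affineIndependent_iff.mp hind) univ c hc0 hc j (mem_univ j)
  have hJ : Fintype.card J ≤ Fintype.card C := by
    simpa using hlin.fintype_card_le_finrank
  have hcoord (e : C) : ∑ j, w j * v (f j) e = k / Fintype.card ι := by
    simpa [q] using congrFun hwq e
  set a : ℝ := k / Fintype.card ι
  have hNa : Fintype.card C * a = m := by
    have h : ∑ e, ∑ j, w j * v (f j) e = Fintype.card C * a := by simp [hcoord]
    rw [← h, sum_comm]
    simp [← mul_sum, hv_sum, ← sum_mul, hw1]
  have hbound (i : J) : (m - 1) * w i ≤ m * a - 1 := by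
    have h1 : ∑ j, w j * #(B (f i) ∩ B (f j)) = m * a := by
      simp only [← hv_inter, mul_sum]
      rw [sum_comm, ← hv_sum (f i), sum_mul]
      refine sum_congr rfl fun e _ => ?_
      rw [← hcoord e, mul_sum]
      exact sum_congr rfl fun j _ => by ring
    have h2 : ∑ j, (w j + if j = i then (m - 1) * w i else 0) ≤
        ∑ j, w j * #(B (f i) ∩ B (f j)) := by
      refine sum_le_sum fun j _ => ?_
      split_ifs with h
      · subst h
        rw [inter_self, hcard]
        linarith
      · have : (1 : ℝ) ≤ #(B (f i) ∩ B (f j)) := by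
          exact_mod_cast (hint (f i) (f j)).card_pos
        nlinarith [hw j]
    rw [h1, sum_add_distrib, hw1] at h2
    simp only [sum_ite_eq', mem_univ, if_true] at h2
    linarith
  have hm1 : (1 : ℝ) ≤ m := by exact_mod_cast hm
  have hJne : Nonempty J := by
    by_contra h
    rw [not_nonempty_iff] at h
    simp at hw1
  have hpos : 0 ≤ m * a - 1 :=
    (mul_nonneg (sub_nonneg.mpr hm1) (hw hJne.some).le).trans (hbound _)
  have hsum : (m : ℝ) - 1 ≤ Fintype.card J * (m * a - 1) := by
    have h := sum_le_sum fun i (_ : i ∈ univ) => hbound i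
    rw [← mul_sum, hw1, sum_const, nsmul_eq_mul, mul_one] at h
    exact h
  have hJ' : (Fintype.card J : ℝ) ≤ Fintype.card C := by exact_mod_cast hJ
  have hfinal : (Fintype.card C : ℝ) + m ≤ m ^ 2 + 1 := by
    have h := hsum.trans (mul_le_mul_of_nonneg_right hJ' hpos)
    linear_combination h + (m : ℝ) * hNa
  exact_mod_cast hfinal

/-- If `H` is the stabilizer of `α` and the `H`-orbit of `β` has size prime to `p`, then every
`p`-element of `H` has an `H`-conjugate fixing `β`. -/
theorem exists_conj_mem_stabilizer_of_not_dvd {G Ω : Type*} [Group G] [Finite Ω]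
    [MulAction G Ω] {α β : Ω} {p : ℕ} [Fact p.Prime] {x : G}
    (hx : x ∈ MulAction.stabilizer G α) (hord : ∃ n : ℕ, orderOf x = p ^ n)
    (hβ : ¬ p ∣ Nat.card (MulAction.orbit (MulAction.stabilizer G α) β)) :
    ∃ y, IsConj x y ∧ y • α = α ∧ y • β = β := by
  let x' : MulAction.stabilizer G α := ⟨x, hx⟩
  have hP : IsPGroup p (Subgroup.zpowers x') := by
    obtain ⟨n, hn⟩ := hord
    refine IsPGroup.of_card (n := n) ?_
    rw [Nat.card_zpowers, ← hn, ← Subgroup.orderOf_coe]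
  obtain ⟨⟨_, h, rfl⟩, hfix⟩ := hP.nonempty_fixed_point_of_prime_not_dvd_card
    (MulAction.orbit (MulAction.stabilizer G α) β) hβ
  have hxh : x • h.1 • β = h.1 • β :=
    congrArg Subtype.val (hfix ⟨x', Subgroup.mem_zpowers x'⟩)
  have hα : h.1 • α = α := h.2
  have hxα : x • α = α := hx
  refine ⟨h.1⁻¹ * x * h.1, isConj_iff.mpr ⟨h.1⁻¹, by simp⟩, ?_, ?_⟩
  · rw [mul_smul, mul_smul, hα, hxα, inv_smul_eq_iff, hα]
  · rw [mul_smul, mul_smul, hxh, inv_smul_smul]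

/-- Lemma 2.5(ii): if `x ∈ H` is a nontrivial `p`-element with
`|x^G| > |x^G ∩ H|² − |x^G ∩ H| + 1`, then `G` has a subdegree divisible by `p`. -/
theorem stmt6 {G Ω : Type*} [Group G] [Finite G] [Finite Ω] [MulAction G Ω]
    [FaithfulSMul G Ω] (α : Ω) (p : ℕ) (hp : p.Prime) (x : G)
    (hxH : x ∈ MulAction.stabilizer G α) (hx1 : x ≠ 1)
    (hord : ∃ n : ℕ, orderOf x = p ^ n)
    (hbig : Nat.card (conjugatesOf x) >
      (Nat.card ↥(conjugatesOf x ∩ (MulAction.stabilizer G α : Set G))) ^ 2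
        - Nat.card ↥(conjugatesOf x ∩ (MulAction.stabilizer G α : Set G)) + 1) :
    ∃ β : Ω, p ∣ Nat.card (MulAction.orbit (MulAction.stabilizer G α) β) := by
  classical
  by_contra! hndvd
  have : Fact p.Prime := ⟨hp⟩
  have := Fintype.ofFinite G
  let B : G → Finset (conjugatesOf x) := fun g => {e | e.1 • g • α = g • α}
  have hB (g : G) (e : conjugatesOf x) : e ∈ B g ↔ e.1 • g • α = g • α := by simp [B]
  let c (g : G) : conjugatesOf x ≃ conjugatesOf x :=
    (MulAut.conj g).toEquiv.subtypeEquiv fun e =>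
      ⟨fun h => IsConj.trans h (isConj_iff.mpr ⟨g, rfl⟩),
        fun h => IsConj.trans h (isConj_iff.mpr ⟨g, rfl⟩).symm⟩
  have hc (g t : G) (e : conjugatesOf x) : c g e ∈ B (g * t) ↔ e ∈ B t := by
    rw [hB, hB]
    change (g * e.1 * g⁻¹) • (g * t) • α = (g * t) • α ↔ _
    simp [mul_smul]
  have hcard (g : G) : (B g).card = (B 1).card :=
    (Finset.card_equiv (c g) fun e => by simpa using (hc g 1 e).symm).symm
  have hm : Nat.card ↥(conjugatesOf x ∩ (MulAction.stabilizer G α : Set G)) = (B 1).card := by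
    rw [← Nat.card_eq_finsetCard]
    refine Nat.card_congr ((Equiv.subtypeSubtypeEquivSubtypeInter _ _).symm.trans
      (Equiv.subtypeEquivRight fun e => ?_))
    simp [hB]
  have hmem : (⟨x, mem_conjugatesOf_self⟩ : conjugatesOf x) ∈ B 1 := by
    simpa [hB] using hxH
  have hint (g h : G) : (B g ∩ B h).Nonempty := by
    obtain ⟨y, hxy, hyα, hyβ⟩ :=
      exists_conj_mem_stabilizer_of_not_dvd hxH hord (hndvd ((g⁻¹ * h) • α))
    let e : conjugatesOf x := ⟨y, hxy⟩
    refine ⟨c g e, Finset.mem_inter.mpr ⟨?_, ?_⟩⟩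
    · simpa using (hc g 1 e).mpr (by simpa [hB] using hyα)
    · simpa using (hc g (g⁻¹ * h) e).mpr ((hB _ _).mpr hyβ)
  have hreg (e : conjugatesOf x) : Finset.card {g | e ∈ B g} =
      Finset.card {g | (⟨x, mem_conjugatesOf_self⟩ : conjugatesOf x) ∈ B g} := by
    obtain ⟨t, ht⟩ := isConj_iff.mp e.2
    obtain rfl : c t ⟨x, mem_conjugatesOf_self⟩ = e := Subtype.ext ht
    exact (Finset.card_equiv (Equiv.mulLeft t) fun g => by simp [hc]).symm
  have hle := card_add_le_of_regular_intersecting B (Finset.card_pos.mpr ⟨_, hmem⟩)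
    hcard hint hreg
  rw [hm, Nat.card_eq_fintype_card] at hbig
  have : (B 1).card ≤ (B 1).card ^ 2 := Nat.le_self_pow two_ne_zero _
  omega
end

section
/- Let G = A_{kℓ} or S_{kℓ} with k, ℓ ≥ 2 and kℓ ≥ 5, acting on the set of partitions of a kℓ-element set into ℓ parts of size k. Then G is 3/2-transitive if and only if (k, ℓ) = (3, 2), and in that case G is in fact 2-transitive. -/
open Pointwise

/-- A transitive permutation group is `3/2`-transitive if all orbits of a point
stabiliser on the points different from the fixed point have the same size,
this size being greater than 1. -/
def IsThreeHalvesTransitive (G Ω : Type*) [Group G] [MulAction G Ω] : Prop :=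
  MulAction.IsPretransitive G Ω ∧ ∀ α : Ω, ∃ s : ℕ, 1 < s ∧
    ∀ β : Ω, β ≠ α → Nat.card (MulAction.orbit (MulAction.stabilizer G α) β) = s

/-- A group action is 2-transitive if it acts transitively on ordered pairs of
distinct points. -/
def IsTwoTransitive (G Ω : Type*) [Group G] [MulAction G Ω] : Prop :=
  ∀ a b c d : Ω, a ≠ b → c ≠ d → ∃ g : G, g • a = c ∧ g • b = d

/-- The set of partitions of `{1, …, kl}` into `l` parts of size `k`, as a
sub-action of the action of `Sym(kl)` on finite sets of finite sets. -/
def partitionsSubMulAction (k l : ℕ) :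
    SubMulAction (Equiv.Perm (Fin (k * l))) (Finset (Finset (Fin (k * l)))) where
  carrier := {P | (∀ s ∈ P, s.card = k) ∧ P.card = l ∧
    ∀ x : Fin (k * l), ∃! s : Finset (Fin (k * l)), s ∈ P ∧ x ∈ s}
  smul_mem' := by
    rintro g P ⟨h1, h2, h3⟩
    refine ⟨?_, ?_, ?_⟩
    · intro s hs
      rw [Finset.mem_smul_finset] at hs
      obtain ⟨t, ht, rfl⟩ := hs
      rw [Finset.card_smul_finset]
      exact h1 t ht
    · rw [Finset.card_smul_finset]; exact h2
    · intro x
      obtain ⟨s, ⟨hsP, hxs⟩, huniq⟩ := h3 (g⁻¹ • x)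
      refine ⟨g • s, ⟨Finset.smul_mem_smul_finset hsP, ?_⟩, ?_⟩
      · have h := Finset.smul_mem_smul_finset (a := g) hxs
        simpa using h
      · rintro s' ⟨hs'P, hxs'⟩
        rw [Finset.mem_smul_finset] at hs'P
        obtain ⟨t, ht, rfl⟩ := hs'P
        have hxt : g⁻¹ • x ∈ t := by
          rw [Finset.mem_smul_finset] at hxs'
          obtain ⟨y, hy, hyx⟩ := hxs'
          have hyx' : y = g⁻¹ • x := by rw [← hyx]; simp
          rwa [← hyx']
        rw [huniq t ⟨ht, hxt⟩]

/-- Two points lie in a common part of the partition `P`. -/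
def SamePart {k l : ℕ} (P : partitionsSubMulAction k l) (x y : Fin (k * l)) : Prop :=
  ∃ s ∈ P.1, x ∈ s ∧ y ∈ s

/-- A chart of `P` identifies the parts of `P` with the rows of `Fin l × Fin k`. -/
def IsChart {k l : ℕ} (e : Fin (k * l) ≃ Fin l × Fin k) (P : partitionsSubMulAction k l) : Prop :=
  ∀ x y, SamePart P x y ↔ (e x).1 = (e y).1

lemma exists_isChart {k l : ℕ} (P : partitionsSubMulAction k l) : ∃ e, IsChart e P := by
  obtain ⟨P, h1, h2, h3⟩ := P
  have h3' := h3
  choose p hp hu using h3'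
  let E₁ : P ≃ Fin l := Finset.equivFinOfCardEq h2
  let E₂ : ∀ s : P, s.1 ≃ Fin k := fun s => Finset.equivFinOfCardEq (h1 s.1 s.2)
  have key : ∀ (s t : P) (x : s.1) (y : t.1), s = t → E₂ s x = E₂ t y → (x : Fin (k * l)) = y := by
    rintro s t x y rfl h
    rw [(E₂ s).injective h]
  let f : Fin (k * l) → Fin l × Fin k := fun x =>
    (E₁ ⟨p x, (hp x).1⟩, E₂ ⟨p x, (hp x).1⟩ ⟨x, (hp x).2⟩)
  have hf : Function.Bijective f := by
    rw [Fintype.bijective_iff_injective_and_card]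
    refine ⟨fun x y hxy => ?_, by simp [mul_comm]⟩
    have h := Prod.ext_iff.1 hxy
    exact key _ _ ⟨x, (hp x).2⟩ ⟨y, (hp y).2⟩ (E₁.injective h.1) h.2
  refine ⟨Equiv.ofBijective f hf, fun x y => ?_⟩
  have : (f x).1 = (f y).1 ↔ p x = p y := by simp [f]
  rw [Equiv.ofBijective_apply, Equiv.ofBijective_apply, this]
  constructor
  · rintro ⟨s, hs, hx, hy⟩
    rw [← hu x s ⟨hs, hx⟩, ← hu y s ⟨hs, hy⟩]
  · intro h
    exact ⟨p x, (hp x).1, (hp x).2, h ▸ (hp y).2⟩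

lemma partition_ext {k l : ℕ} (hk : 0 < k) {P Q : partitionsSubMulAction k l}
    (h : ∀ x y, SamePart P x y ↔ SamePart Q x y) : P = Q := by
  have aux : ∀ P Q : partitionsSubMulAction k l, (∀ x y, SamePart P x y ↔ SamePart Q x y) →
      P.1 ⊆ Q.1 := by
    rintro ⟨P, h1, h2, h3⟩ ⟨Q, h1', h2', h3'⟩ hPQ s (hs : s ∈ P)
    change s ∈ Q
    obtain ⟨x, hx⟩ : s.Nonempty := Finset.card_pos.1 (by rw [h1 s hs]; exact hk)
    obtain ⟨t, ⟨ht, hxt⟩, hut⟩ := h3' x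
    convert ht
    ext y
    constructor
    · intro hy
      obtain ⟨t', ht', hx', hy'⟩ := (hPQ x y).1 ⟨s, hs, hx, hy⟩
      rwa [← hut t' ⟨ht', hx'⟩]
    · intro hy
      obtain ⟨s', hs', hx', hy'⟩ := (hPQ x y).2 ⟨t, ht, hxt, hy⟩
      rwa [(h3 x).unique ⟨hs, hx⟩ ⟨hs', hx'⟩]
  exact Subtype.ext ((aux P Q h).antisymm (aux Q P fun x y => (h x y).symm))

lemma samePart_smul {k l : ℕ} (g : Equiv.Perm (Fin (k * l))) (P : partitionsSubMulAction k l)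
    (x y : Fin (k * l)) : SamePart (g • P) x y ↔ SamePart P (g⁻¹ x) (g⁻¹ y) := by
  simp only [SamePart, SubMulAction.val_smul]
  constructor
  · rintro ⟨s, hs, hx, hy⟩
    obtain ⟨t, ht, rfl⟩ := Finset.mem_smul_finset.1 hs
    exact ⟨t, ht, Finset.inv_smul_mem_iff.2 hx, Finset.inv_smul_mem_iff.2 hy⟩
  · rintro ⟨s, hs, hx, hy⟩
    exact ⟨g • s, Finset.smul_mem_smul_finset hs, Finset.inv_smul_mem_iff.1 hx,
      Finset.inv_smul_mem_iff.1 hy⟩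

lemma IsChart.samePart_smul {k l : ℕ} {e : Fin (k * l) ≃ Fin l × Fin k}
    {P : partitionsSubMulAction k l} (he : IsChart e P) (g : Equiv.Perm (Fin (k * l)))
    (x y : Fin (k * l)) : SamePart (g • P) x y ↔ (e (g⁻¹ x)).1 = (e (g⁻¹ y)).1 := by
  rw [_root_.samePart_smul, he]

lemma exists_perm_apply_eq {ι α : Type*} [Finite α] (f g : ι → α)
    (h : ∀ i j, f i = f j ↔ g i = g j) : ∃ σ : Equiv.Perm α, ∀ i, σ (f i) = g i := by
  classical
  let E : Set.range f → Set.range g := fun a => ⟨g a.2.choose, _, rfl⟩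
  have hE : ∀ i, (E ⟨f i, i, rfl⟩ : α) = g i := fun i =>
    (h _ _).1 (⟨f i, i, rfl⟩ : Set.range f).2.choose_spec
  have hbij : Function.Bijective E := by
    constructor
    · rintro ⟨_, i, rfl⟩ ⟨_, j, rfl⟩ hij
      have := congrArg Subtype.val hij
      rw [hE, hE] at this
      exact Subtype.ext ((h i j).2 this)
    · rintro ⟨_, i, rfl⟩
      exact ⟨⟨f i, i, rfl⟩, Subtype.ext (hE i)⟩
  have := Fintype.ofFinite α
  refine ⟨(Equiv.ofBijective E hbij).extendSubtype, fun i => ?_⟩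
  rw [Equiv.extendSubtype_apply_of_mem _ _ ⟨i, rfl⟩]
  exact hE i

/-- Homogeneity: every map between finite configurations preserving the relation of lying in a
common part is induced by a permutation matching the two partitions. -/
lemma exists_smul_eq_of_samePart_iff {k l : ℕ} (hk : 0 < k) {ι : Type*}
    {P P' : partitionsSubMulAction k l} (f f' : ι → Fin (k * l))
    (hinj : ∀ i j, f i = f j ↔ f' i = f' j)
    (h : ∀ i j, SamePart P (f i) (f j) ↔ SamePart P' (f' i) (f' j)) :
    ∃ g : Equiv.Perm (Fin (k * l)), g • P = P' ∧ ∀ i, g (f i) = f' i := by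
  obtain ⟨e, he⟩ := exists_isChart P
  obtain ⟨e', he'⟩ := exists_isChart P'
  have h' : ∀ i j, (e (f i)).1 = (e (f j)).1 ↔ (e' (f' i)).1 = (e' (f' j)).1 := by
    intro i j; rw [← he, ← he', h]
  obtain ⟨σ, hσ⟩ := exists_perm_apply_eq (fun i => (e (f i)).1) (fun i => (e' (f' i)).1) h'
  have : ∀ a : Fin l, ∃ τ : Equiv.Perm (Fin k), ∀ i : {i // (e (f i)).1 = a},
      τ (e (f i)).2 = (e' (f' i)).2 := by
    intro a
    refine exists_perm_apply_eq (fun i : {i // (e (f i)).1 = a} => (e (f i)).2)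
      (fun i : {i // (e (f i)).1 = a} => (e' (f' i)).2) ?_
    rintro ⟨i, hi⟩ ⟨j, hj⟩
    have h1 := hinj i j
    rw [← e.apply_eq_iff_eq, ← e'.apply_eq_iff_eq, Prod.ext_iff, Prod.ext_iff] at h1
    have h2 := h' i j
    have h3 : (e (f i)).1 = (e (f j)).1 := hi.trans hj.symm
    simp only
    tauto
  choose τ hτ using this
  let g : Equiv.Perm (Fin (k * l)) := (e.trans (Equiv.prodShear σ τ)).trans e'.symm
  have hg : ∀ x, e' (g x) = (σ (e x).1, τ (e x).1 (e x).2) := fun x => by simp [g]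
  refine ⟨g, partition_ext hk fun x y => ?_, fun i => e'.injective ?_⟩
  · rw [he.samePart_smul, he']
    obtain ⟨x, rfl⟩ := g.surjective x
    obtain ⟨y, rfl⟩ := g.surjective y
    simp [hg]
  · rw [hg]
    exact Prod.ext (hσ i) (hτ _ ⟨i, rfl⟩)

lemma swap_smul_of_samePart {k l : ℕ} (hk : 0 < k) {P : partitionsSubMulAction k l}
    {u v : Fin (k * l)} (h : SamePart P u v) : Equiv.swap u v • P = P := by
  obtain ⟨e, he⟩ := exists_isChart P
  refine partition_ext hk fun x y => ?_
  have huv := (he u v).1 h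
  rw [he.samePart_smul, he, Equiv.swap_inv]
  have : ∀ x, (e (Equiv.swap u v x)).1 = (e x).1 := by
    intro x
    rw [Equiv.swap_apply_def]
    split_ifs <;> simp_all
  rw [this, this]

/-- Homogeneity inside any group containing the alternating group. -/
lemma exists_mem_smul_eq_of_samePart_iff {k l : ℕ} (hk : 0 < k)
    {G : Subgroup (Equiv.Perm (Fin (k * l)))} (hG : alternatingGroup (Fin (k * l)) ≤ G) {ι : Type*}
    {P P' : partitionsSubMulAction k l} (f f' : ι → Fin (k * l))
    (hinj : ∀ i j, f i = f j ↔ f' i = f' j)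
    (h : ∀ i j, SamePart P (f i) (f j) ↔ SamePart P' (f' i) (f' j))
    (hfree : ∃ u v, u ≠ v ∧ SamePart P u v ∧ ∀ i, f i ≠ u ∧ f i ≠ v) :
    ∃ g ∈ G, g • P = P' ∧ ∀ i, g (f i) = f' i := by
  obtain ⟨g, hgP, hgf⟩ := exists_smul_eq_of_samePart_iff hk f f' hinj h
  obtain ⟨u, v, huv, hs, hne⟩ := hfree
  rcases Int.units_eq_one_or (Equiv.Perm.sign g) with hg | hg
  · exact ⟨g, hG (Equiv.Perm.mem_alternatingGroup.2 hg), hgP, hgf⟩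
  · refine ⟨g * Equiv.swap u v, hG (Equiv.Perm.mem_alternatingGroup.2 ?_), ?_, fun i => ?_⟩
    · simp [hg, Equiv.Perm.sign_swap huv]
    · rw [mul_smul, swap_smul_of_samePart hk hs, hgP]
    · rw [Equiv.Perm.mul_apply, Equiv.swap_apply_of_ne_of_ne (hne i).1 (hne i).2, hgf]

/-- The orbit of `Q` under the stabiliser of `P` in `G`. -/
def suborbit {k l : ℕ} (G : Subgroup (Equiv.Perm (Fin (k * l)))) (P Q : partitionsSubMulAction k l) :
    Set (partitionsSubMulAction k l) :=
  MulAction.orbit (MulAction.stabilizer G P) Q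

lemma mem_suborbit {k l : ℕ} {G : Subgroup (Equiv.Perm (Fin (k * l)))}
    {P Q R : partitionsSubMulAction k l} :
    R ∈ suborbit G P Q ↔ ∃ g ∈ G, g • P = P ∧ g • Q = R := by
  constructor
  · rintro ⟨⟨⟨g, hg⟩, hgP⟩, rfl⟩
    exact ⟨g, hg, hgP, rfl⟩
  · rintro ⟨g, hg, hgP, rfl⟩
    exact ⟨⟨⟨g, hg⟩, hgP⟩, rfl⟩

/-- Injective families of `m` points lying in pairwise distinct parts of `P`. -/
abbrev Transversal {k l : ℕ} (P : partitionsSubMulAction k l) (m : ℕ) : Type :=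
  {f : Fin m → Fin (k * l) // ∀ i j, SamePart P (f i) (f j) → i = j}

lemma card_transversal {k l : ℕ} (P : partitionsSubMulAction k l) (m : ℕ) :
    Nat.card (Transversal P m) = l.descFactorial m * k ^ m := by
  obtain ⟨e, he⟩ := exists_isChart P
  let E : Transversal P m ≃ (Fin m ↪ Fin l) × (Fin m → Fin k) :=
    { toFun := fun f => (⟨fun i => (e (f.1 i)).1, fun i j h => f.2 i j ((he _ _).2 h)⟩,
        fun i => (e (f.1 i)).2)
      invFun := fun p => ⟨fun i => e.symm (p.1 i, p.2 i), fun i j h => by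
        rw [he] at h
        simpa using h⟩
      left_inv := fun f => Subtype.ext (funext fun i => e.symm_apply_apply _)
      right_inv := fun p => by ext <;> simp }
  rw [Nat.card_congr E, Nat.card_prod, Nat.card_eq_fintype_card, Fintype.card_embedding_eq]
  simp

lemma samePart_refl {k l : ℕ} (P : partitionsSubMulAction k l) (x : Fin (k * l)) :
    SamePart P x x := by
  obtain ⟨e, he⟩ := exists_isChart P
  rw [he]

lemma samePart_comm {k l : ℕ} {P : partitionsSubMulAction k l} {x y : Fin (k * l)} :
    SamePart P x y ↔ SamePart P y x := by
  obtain ⟨e, he⟩ := exists_isChart P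
  rw [he, he, eq_comm]

lemma smul_swap_smul {k l : ℕ} {P P' : partitionsSubMulAction k l} {g : Equiv.Perm (Fin (k * l))}
    (hg : g • P = P') (x y : Fin (k * l)) :
    g • Equiv.swap x y • P = Equiv.swap (g x) (g y) • P' := by
  rw [← hg, ← mul_smul, ← mul_smul, Equiv.mul_swap_eq_swap_mul]

/-- Any part has a further point. -/
lemma IsChart.exists_ne {k l : ℕ} (hk : 2 ≤ k) (e : Fin (k * l) ≃ Fin l × Fin k)
    (x : Fin (k * l)) : ∃ w, w ≠ x ∧ (e w).1 = (e x).1 := by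
  have : Nontrivial (Fin k) := Fin.nontrivial_iff_two_le.2 hk
  obtain ⟨b, hb⟩ := _root_.exists_ne (e x).2
  refine ⟨e.symm ((e x).1, b), ?_, by simp⟩
  rintro h
  apply hb
  have := congrArg (fun t => (e t).2) h
  simpa using this

lemma IsChart.exists_ne_ne {k l : ℕ} (hk : 3 ≤ k) (e : Fin (k * l) ≃ Fin l × Fin k)
    (x y : Fin (k * l)) : ∃ w, w ≠ x ∧ w ≠ y ∧ (e w).1 = (e x).1 := by
  obtain ⟨b, hb⟩ := Finset.exists_mem_notMem_of_card_lt_card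
    (s := ({(e x).2, (e y).2} : Finset (Fin k))) (t := Finset.univ)
    (Finset.card_le_two.trans_lt (by simp; omega))
  simp only [Finset.mem_univ, Finset.mem_insert, Finset.mem_singleton, not_or, true_and] at hb
  refine ⟨e.symm ((e x).1, b), ?_, ?_, by simp⟩
  · rintro h
    exact hb.1 (by simpa using congrArg (fun t => (e t).2) h)
  · rintro h
    exact hb.2 (by simpa using congrArg (fun t => (e t).2) h)

lemma IsChart.eq_or_eq {k l : ℕ} (hk : k = 2) (e : Fin (k * l) ≃ Fin l × Fin k)
    {a b : Fin (k * l)} (hab : b ≠ a) (h : (e b).1 = (e a).1) (u : Fin (k * l))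
    (hu : (e u).1 = (e a).1) : u = a ∨ u = b := by
  by_contra! hc
  have h1 : ∀ {a b : Fin (k * l)}, a ≠ b → (e a).1 = (e b).1 → (e a).2 ≠ (e b).2 :=
    fun hne h h' => hne (e.injective (Prod.ext h h'))
  have h2 := Fin.val_ne_of_ne (h1 hab h)
  have h3 := Fin.val_ne_of_ne (h1 hc.1 hu)
  have h4 := Fin.val_ne_of_ne (h1 hc.2 (hu.trans h.symm))
  omega

lemma samePart_swap_smul {k l : ℕ} {P : partitionsSubMulAction k l}
    {e : Fin (k * l) ≃ Fin l × Fin k} (he : IsChart e P) (x y u v : Fin (k * l)) :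
    SamePart (Equiv.swap x y • P) u v ↔
      (if u = x then (e y).1 else if u = y then (e x).1 else (e u).1) =
      (if v = x then (e y).1 else if v = y then (e x).1 else (e v).1) := by
  have : ∀ u, (e (Equiv.swap x y u)).1 =
      if u = x then (e y).1 else if u = y then (e x).1 else (e u).1 := by
    intro u
    rw [Equiv.swap_apply_def]
    split_ifs <;> rfl
  rw [he.samePart_smul, Equiv.swap_inv, this, this]

lemma exists_transversal_swap_eq {k l : ℕ} {G : Subgroup (Equiv.Perm (Fin (k * l)))}
    {P R : partitionsSubMulAction k l} {x y : Fin (k * l)} (hxy : ¬ SamePart P x y)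
    (hR : R ∈ suborbit G P (Equiv.swap x y • P)) :
    ∃ f : Transversal P 2, Equiv.swap (f.1 0) (f.1 1) • P = R := by
  obtain ⟨g, -, hgP, rfl⟩ := mem_suborbit.1 hR
  have hne : ¬ SamePart P (g x) (g y) := by
    rw [← hgP, samePart_smul]
    simpa using hxy
  have hne' : ¬ SamePart P (g y) (g x) := fun h => hne (samePart_comm.1 h)
  rw [smul_swap_smul hgP]
  refine ⟨⟨![g x, g y], ?_⟩, rfl⟩
  intro i j
  fin_cases i <;> fin_cases j <;> simp [hne, hne']

lemma swap_transversal_smul_eq {k l : ℕ} (hk : k = 2) {P : partitionsSubMulAction k l}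
    {e : Fin (k * l) ≃ Fin l × Fin k} (he : IsChart e P) {x y x' y' : Fin (k * l)}
    (hxy : (e x).1 ≠ (e y).1) (hx : x' ≠ x) (hx' : (e x').1 = (e x).1)
    (hy : y' ≠ y) (hy' : (e y').1 = (e y).1) :
    Equiv.swap x' y' • P = Equiv.swap x y • P := by
  have kx := IsChart.eq_or_eq hk e hx hx'
  have ky := IsChart.eq_or_eq hk e hy hy'
  refine partition_ext (by omega) fun u v => ?_
  rw [samePart_swap_smul he, samePart_swap_smul he]
  have := kx u
  have := kx v
  have := ky u
  have := ky v
  grind (splits := 30)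

/-- An upper bound for the suborbit of a transposed partition. -/
lemma mul_card_suborbit_swap_le {k l : ℕ} (hk : 2 ≤ k) (G : Subgroup (Equiv.Perm (Fin (k * l))))
    {P : partitionsSubMulAction k l} {x y : Fin (k * l)} (hxy : ¬ SamePart P x y) {c : ℕ}
    (hc : c ≤ 2 ∨ k = 2 ∧ c ≤ 4) :
    c * Nat.card (suborbit G P (Equiv.swap x y • P)) ≤ l.descFactorial 2 * k ^ 2 := by
  classical
  rw [← card_transversal P 2]
  obtain ⟨e, he⟩ := exists_isChart P
  let F : Transversal P 2 → partitionsSubMulAction k l := fun f => Equiv.swap (f.1 0) (f.1 1) • P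
  have hsub : suborbit G P (Equiv.swap x y • P) ⊆ (Finset.univ.image F : Finset _) := by
    intro R hR
    obtain ⟨f, rfl⟩ := exists_transversal_swap_eq hxy hR
    simp only [Finset.coe_image, Finset.coe_univ, Set.image_univ, Set.mem_range]
    exact ⟨f, rfl⟩
  have hcard : Nat.card (suborbit G P (Equiv.swap x y • P)) ≤ (Finset.univ.image F).card := by
    rw [← Set.ncard_coe_finset]
    exact Set.ncard_le_ncard hsub (Finset.finite_toSet _)
  refine (Nat.mul_le_mul_left c hcard).trans ?_
  rw [Nat.card_eq_fintype_card, ← Finset.card_univ]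
  refine Finset.mul_card_image_le_card (f := F) Finset.univ c fun a ha => ?_
  obtain ⟨⟨f, hf⟩, -, rfl⟩ := Finset.mem_image.1 ha
  set x := f 0
  set y := f 1
  have hrow : (e x).1 ≠ (e y).1 := fun h => absurd (hf 0 1 ((he _ _).2 h)) (by decide)
  have hmem : ∀ u v, (e u).1 ≠ (e v).1 → Equiv.swap u v • P = Equiv.swap x y • P →
      u ∈ ({f' : Transversal P 2 | F f' = F ⟨f, hf⟩} : Finset _).image fun f' => f'.1 0 := by
    intro u v huv h
    refine Finset.mem_image.2 ⟨⟨![u, v], ?_⟩, Finset.mem_filter.2 ⟨Finset.mem_univ _, h⟩, rfl⟩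
    intro i j
    rw [he]
    fin_cases i <;> fin_cases j <;> simp [huv, huv.symm]
  refine le_trans ?_ (Finset.card_image_le (f := fun f' : Transversal P 2 => f'.1 0))
  have hx := hmem x y hrow rfl
  have hy := hmem y x hrow.symm (by rw [Equiv.swap_comm])
  have hne : x ≠ y := ne_of_apply_ne (fun t => (e t).1) hrow
  rcases hc with hc | ⟨hk2, hc⟩
  · refine hc.trans ?_
    refine (Finset.card_pair hne).symm.le.trans ?_
    exact Finset.card_le_card (by simp [Finset.insert_subset_iff, hx, hy])
  · obtain ⟨x', hx1, hx2⟩ := IsChart.exists_ne hk e x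
    obtain ⟨y', hy1, hy2⟩ := IsChart.exists_ne hk e y
    have hsw := swap_transversal_smul_eq hk2 he hrow hx1 hx2 hy1 hy2
    have hrow' : (e x').1 ≠ (e y').1 := by rwa [hx2, hy2]
    have hx' := hmem x' y' hrow' hsw
    have hy' := hmem y' x' hrow'.symm (by rw [Equiv.swap_comm, hsw])
    have hcard : ({x, y, x', y'} : Finset (Fin (k * l))).card = 4 := by
      have h1 : x ≠ y' := by rintro h; exact hrow (by rw [h, hy2])
      have h2 : y ≠ x' := by rintro h; exact hrow (by rw [h, hx2])
      have h3 : x' ≠ y' := ne_of_apply_ne (fun t => (e t).1) hrow'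
      simp [Finset.card_insert_of_notMem, hne, h1, h2, h3, hx1.symm, hy1.symm]
    refine hc.trans ?_
    refine hcard.symm.le.trans ?_
    exact Finset.card_le_card (by simp only [Finset.insert_subset_iff, hx, hy, hx', hy',
      Finset.singleton_subset_iff, and_self])

/-- The image of `P` under the `3`-cycle through the points `x`, `y`, `z`. -/
def cycleThree {k l : ℕ} (P : partitionsSubMulAction k l) (x y z : Fin (k * l)) :
    partitionsSubMulAction k l :=
  (Equiv.swap x y * Equiv.swap y z) • P

lemma cycleThree_rotate {k l : ℕ} (P : partitionsSubMulAction k l) {x y z : Fin (k * l)}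
    (hxy : x ≠ y) (hyz : y ≠ z) (hxz : x ≠ z) : cycleThree P x y z = cycleThree P z x y := by
  unfold cycleThree
  congr 1
  ext u
  simp only [Equiv.Perm.mul_apply, Equiv.swap_apply_def]
  grind

lemma samePart_cycleThree {k l : ℕ} {P : partitionsSubMulAction k l}
    {e : Fin (k * l) ≃ Fin l × Fin k} (he : IsChart e P) {x y z : Fin (k * l)}
    (hxy : x ≠ y) (hyz : y ≠ z) (hxz : x ≠ z) (u v : Fin (k * l)) :
    SamePart (cycleThree P x y z) u v ↔
      (if u = x then (e z).1 else if u = y then (e x).1 else if u = z then (e y).1 else (e u).1) =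
      (if v = x then (e z).1 else if v = y then (e x).1 else if v = z then (e y).1
        else (e v).1) := by
  have : ∀ u, (e ((Equiv.swap x y * Equiv.swap y z)⁻¹ u)).1 = if u = x then (e z).1 else
      if u = y then (e x).1 else if u = z then (e y).1 else (e u).1 := by
    intro u
    simp only [mul_inv_rev, Equiv.swap_inv, Equiv.Perm.mul_apply, Equiv.swap_apply_def]
    grind
  rw [cycleThree, he.samePart_smul, this, this]

lemma cycleThree_inj_last {k l : ℕ} (hk : 2 ≤ k) {P : partitionsSubMulAction k l}
    {e : Fin (k * l) ≃ Fin l × Fin k} (he : IsChart e P) {x y z y' z' : Fin (k * l)}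
    (hxy : (e x).1 ≠ (e y).1) (hyz : (e y).1 ≠ (e z).1) (hxz : (e x).1 ≠ (e z).1)
    (hxy' : (e x).1 ≠ (e y').1) (hyz' : (e y').1 ≠ (e z').1) (hxz' : (e x).1 ≠ (e z').1)
    (h : cycleThree P x y z = cycleThree P x y' z') : z = z' := by
  have key := fun u v => (samePart_cycleThree he (ne_of_apply_ne (fun t => (e t).1) hxy)
    (ne_of_apply_ne (fun t => (e t).1) hyz) (ne_of_apply_ne (fun t => (e t).1) hxz) u v).symm.trans
    ((iff_of_eq (congrArg (fun Q => SamePart Q u v) h)).trans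
    (samePart_cycleThree he (ne_of_apply_ne (fun t => (e t).1) hxy')
    (ne_of_apply_ne (fun t => (e t).1) hyz') (ne_of_apply_ne (fun t => (e t).1) hxz') u v))
  obtain ⟨w, hwz, hw⟩ := IsChart.exists_ne hk e z
  have h1 := key w x
  have h2 := key z x
  grind

lemma cycleThree_inj {k l : ℕ} (hk : 2 ≤ k) {P : partitionsSubMulAction k l}
    {e : Fin (k * l) ≃ Fin l × Fin k} (he : IsChart e P) {x y z y' z' : Fin (k * l)}
    (hxy : (e x).1 ≠ (e y).1) (hyz : (e y).1 ≠ (e z).1) (hxz : (e x).1 ≠ (e z).1)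
    (hxy' : (e x).1 ≠ (e y').1) (hyz' : (e y').1 ≠ (e z').1) (hxz' : (e x).1 ≠ (e z').1)
    (h : cycleThree P x y z = cycleThree P x y' z') : y = y' ∧ z = z' := by
  have hz := cycleThree_inj_last hk he hxy hyz hxz hxy' hyz' hxz' h
  subst hz
  have ne := fun {a b} (h : (e a).1 ≠ (e b).1) => ne_of_apply_ne (fun t => (e t).1) h
  rw [cycleThree_rotate P (ne hxy) (ne hyz) (ne hxz),
    cycleThree_rotate P (ne hxy') (ne hyz') (ne hxz')] at h
  exact ⟨cycleThree_inj_last hk he hxz.symm hxy hyz.symm hxz.symm hxy' hyz'.symm h, rfl⟩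

/-- If two transversal triples define the same image of `P`, then any point moved by the second
is in `{x, y, z}`, or `k = 2` and it is in the part of one of these points. -/
lemma mem_of_cycleThree_eq {k l : ℕ} (hk : 2 ≤ k) {P : partitionsSubMulAction k l}
    {e : Fin (k * l) ≃ Fin l × Fin k} (he : IsChart e P) {x y z x' y' z' : Fin (k * l)}
    (hxy : (e x).1 ≠ (e y).1) (hyz : (e y).1 ≠ (e z).1) (hxz : (e x).1 ≠ (e z).1)
    (hxy' : (e x').1 ≠ (e y').1) (hyz' : (e y').1 ≠ (e z').1) (hxz' : (e x').1 ≠ (e z').1)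
    (h : cycleThree P x y z = cycleThree P x' y' z') :
    (x' = x ∨ x' = y ∨ x' = z) ∨
      (k = 2 ∧ ((e x').1 = (e x).1 ∨ (e x').1 = (e y).1 ∨ (e x').1 = (e z).1)) := by
  have key := fun u v => (samePart_cycleThree he (ne_of_apply_ne (fun t => (e t).1) hxy)
    (ne_of_apply_ne (fun t => (e t).1) hyz) (ne_of_apply_ne (fun t => (e t).1) hxz) u v).symm.trans
    ((iff_of_eq (congrArg (fun Q => SamePart Q u v) h)).trans
    (samePart_cycleThree he (ne_of_apply_ne (fun t => (e t).1) hxy')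
    (ne_of_apply_ne (fun t => (e t).1) hyz') (ne_of_apply_ne (fun t => (e t).1) hxz') u v))
  by_contra! hc
  obtain ⟨⟨hx, hy, hz⟩, hc⟩ := hc
  by_cases hk2 : k = 2
  · obtain ⟨w, hwx, hw⟩ := IsChart.exists_ne hk e x'
    have h1 := key w x'
    have h2 := hc hk2
    grind
  · by_cases h3 : (e x').1 = (e x).1
    · obtain ⟨w, hwx, hwx', hw⟩ := IsChart.exists_ne_ne (by omega : 3 ≤ k) e x' x
      have h1 := key w x'
      grind
    · by_cases h4 : (e x').1 = (e y).1
      · obtain ⟨w, hwx, hwx', hw⟩ := IsChart.exists_ne_ne (by omega : 3 ≤ k) e x' y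
        have h1 := key w x'
        grind
      · obtain ⟨w, hwx, hwx', hw⟩ := IsChart.exists_ne_ne (by omega : 3 ≤ k) e x' z
        have h1 := key w x'
        grind

lemma smul_cycleThree {k l : ℕ} {P P' : partitionsSubMulAction k l} {g : Equiv.Perm (Fin (k * l))}
    (hg : g • P = P') (x y z : Fin (k * l)) :
    g • cycleThree P x y z = cycleThree P' (g x) (g y) (g z) := by
  rw [cycleThree, cycleThree, mul_smul, mul_smul]
  exact smul_swap_smul (smul_swap_smul hg y z) x y

/-- Some odd permutation fixes both a partition and its image under a transversal `3`-cycle. -/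
lemma exists_odd_smul_cycleThree {k l : ℕ} (hk : 2 ≤ k) {P : partitionsSubMulAction k l}
    {e : Fin (k * l) ≃ Fin l × Fin k} (he : IsChart e P) {x y z : Fin (k * l)}
    (hxy : (e x).1 ≠ (e y).1) (hyz : (e y).1 ≠ (e z).1) (hxz : (e x).1 ≠ (e z).1) :
    ∃ r : Equiv.Perm (Fin (k * l)), Equiv.Perm.sign r = -1 ∧ r • P = P ∧
      r • cycleThree P x y z = cycleThree P x y z := by
  have hxy0 := ne_of_apply_ne (fun t => (e t).1) hxy
  have hyz0 := ne_of_apply_ne (fun t => (e t).1) hyz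
  have hxz0 := ne_of_apply_ne (fun t => (e t).1) hxz
  obtain ⟨x', hx, hx'⟩ := IsChart.exists_ne hk e x
  by_cases hk2 : k = 2
  · obtain ⟨y', hy, hy'⟩ := IsChart.exists_ne hk e y
    obtain ⟨z', hz, hz'⟩ := IsChart.exists_ne hk e z
    have kx := IsChart.eq_or_eq hk2 e hx hx'
    have ky := IsChart.eq_or_eq hk2 e hy hy'
    have kz := IsChart.eq_or_eq hk2 e hz hz'
    let r := Equiv.swap x x' * (Equiv.swap y z' * Equiv.swap y' z)
    have h1 : y ≠ z' := by rintro rfl; exact hyz hz'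
    have h2 : y' ≠ z := by rintro rfl; exact hyz hy'.symm
    have hr : ∀ u, r⁻¹ u = if u = x then x' else if u = x' then x else if u = y then z' else
        if u = z' then y else if u = y' then z else if u = z then y' else u := by
      intro u
      simp only [r, mul_inv_rev, Equiv.swap_inv, Equiv.Perm.mul_apply, Equiv.swap_apply_def]
      grind
    have hr' : r x = x' ∧ r y = z' ∧ r z = y' := by
      simp only [r, Equiv.Perm.mul_apply, Equiv.swap_apply_def]
      grind
    have hrP : r • P = P := by
      refine partition_ext (by omega) fun u v => ?_
      rw [he.samePart_smul, he, hr, hr]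
      have := kx u
      have := kx v
      have := ky u
      have := ky v
      have := kz u
      have := kz v
      clear kx ky kz he
      grind (splits := 30)
    refine ⟨r, ?_, hrP, ?_⟩
    · simp [r, Equiv.Perm.sign_swap hx.symm, Equiv.Perm.sign_swap h1, Equiv.Perm.sign_swap h2]
    · rw [smul_cycleThree hrP, hr'.1, hr'.2.1, hr'.2.2]
      refine partition_ext (by omega) fun u v => ?_
      rw [samePart_cycleThree he hxy0 hyz0 hxz0, samePart_cycleThree he (by grind) (by grind)
        (by grind)]
      have := kx u
      have := kx v
      have := ky u
      have := ky v
      have := kz u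
      have := kz v
      clear kx ky kz he
      grind (splits := 30)
  · obtain ⟨w, hw, hw', hw2⟩ := IsChart.exists_ne_ne (by omega : 3 ≤ k) e x x'
    have hP : Equiv.swap x' w • P = P :=
      swap_smul_of_samePart (by omega) ((he _ _).2 (by rw [hx', hw2]))
    refine ⟨Equiv.swap x' w, Equiv.Perm.sign_swap hw'.symm, hP, ?_⟩
    rw [smul_cycleThree hP]
    simp only [Equiv.swap_apply_def]
    congr 1 <;> grind

/-- A lower bound for the suborbit of the image of a partition under a transversal `3`-cycle. -/
lemma le_mul_card_suborbit_cycleThree {k l : ℕ} (hk : 2 ≤ k)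
    {G : Subgroup (Equiv.Perm (Fin (k * l)))} (hG : alternatingGroup (Fin (k * l)) ≤ G)
    {P : partitionsSubMulAction k l} (f₀ : Transversal P 3) {c : ℕ} (hc : 3 ≤ c)
    (hc' : k = 2 → 6 ≤ c) :
    l.descFactorial 3 * k ^ 3 ≤
      c * Nat.card (suborbit G P (cycleThree P (f₀.1 0) (f₀.1 1) (f₀.1 2))) := by
  classical
  rw [← card_transversal P 3]
  obtain ⟨e, he⟩ := exists_isChart P
  have hrow : ∀ f : Transversal P 3, (e (f.1 0)).1 ≠ (e (f.1 1)).1 ∧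
      (e (f.1 1)).1 ≠ (e (f.1 2)).1 ∧ (e (f.1 0)).1 ≠ (e (f.1 2)).1 := by
    intro f
    refine ⟨?_, ?_, ?_⟩ <;> exact fun h => absurd (f.2 _ _ ((he _ _).2 h)) (by decide)
  let F : Transversal P 3 → partitionsSubMulAction k l :=
    fun f => cycleThree P (f.1 0) (f.1 1) (f.1 2)
  have hsub : ((Finset.univ.image F : Finset _) : Set (partitionsSubMulAction k l)) ⊆
      suborbit G P (cycleThree P (f₀.1 0) (f₀.1 1) (f₀.1 2)) := by
    intro R hR
    simp only [Finset.coe_image, Finset.coe_univ, Set.image_univ, Set.mem_range] at hR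
    obtain ⟨f, rfl⟩ := hR
    have hinj : ∀ f : Transversal P 3, ∀ i j, SamePart P (f.1 i) (f.1 j) ↔ i = j := fun f i j =>
      ⟨f.2 i j, by rintro rfl; exact samePart_refl _ _⟩
    have hinj' : ∀ f : Transversal P 3, ∀ i j, f.1 i = f.1 j ↔ i = j := fun f i j =>
      ⟨fun h => f.2 i j (h ▸ samePart_refl _ _), by rintro rfl; rfl⟩
    obtain ⟨g, hgP, hg⟩ := exists_smul_eq_of_samePart_iff (by omega) f₀.1 f.1
      (fun i j => (hinj' f₀ i j).trans (hinj' f i j).symm)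
      (fun i j => (hinj f₀ i j).trans (hinj f i j).symm)
    have hgQ : g • cycleThree P (f₀.1 0) (f₀.1 1) (f₀.1 2) = F f := by
      rw [smul_cycleThree hgP, hg, hg, hg]
    rw [mem_suborbit]
    rcases Int.units_eq_one_or (Equiv.Perm.sign g) with hs | hs
    · exact ⟨g, hG (Equiv.Perm.mem_alternatingGroup.2 hs), hgP, hgQ⟩
    · obtain ⟨r, hr, hrP, hrQ⟩ :=
        exists_odd_smul_cycleThree hk he (hrow f₀).1 (hrow f₀).2.1 (hrow f₀).2.2
      exact ⟨g * r, hG (Equiv.Perm.mem_alternatingGroup.2 (by simp [hs, hr])),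
        by rw [mul_smul, hrP, hgP], by rw [mul_smul, hrQ, hgQ]⟩
  have hcard : (Finset.univ.image F).card ≤
      Nat.card (suborbit G P (cycleThree P (f₀.1 0) (f₀.1 1) (f₀.1 2))) := by
    rw [← Set.ncard_coe_finset]
    exact Set.ncard_le_ncard hsub (Set.toFinite _)
  refine le_trans ?_ (Nat.mul_le_mul_left c hcard)
  rw [Nat.card_eq_fintype_card, ← Finset.card_univ]
  refine Finset.card_le_mul_card_image (f := F) Finset.univ c fun a ha => ?_
  obtain ⟨f, -, rfl⟩ := Finset.mem_image.1 ha
  have hinj : Set.InjOn (fun f' : Transversal P 3 => f'.1 0)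
      ({f' : Transversal P 3 | F f' = F f} : Finset _) := by
    intro f₁ h₁ f₂ h₂ h0
    simp only [Finset.coe_filter, Finset.mem_univ, true_and, Set.mem_ofPred_eq] at h₁ h₂ h0
    have h12 := h₁.trans h₂.symm
    obtain ⟨a1, a2, a3⟩ := hrow f₁
    obtain ⟨b1, b2, b3⟩ := hrow f₂
    simp only [F] at h12
    rw [← h0] at h12 b1 b3
    have := cycleThree_inj hk he a1 a2 a3 b1 b2 b3 h12
    ext i : 2
    fin_cases i
    · exact h0
    · exact this.1
    · exact this.2
  have hmem : ∀ f' ∈ ({f' : Transversal P 3 | F f' = F f} : Finset _), _ :=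
    fun f' hf' => mem_of_cycleThree_eq hk he (hrow f).1 (hrow f).2.1 (hrow f).2.2
      (hrow f').1 (hrow f').2.1 (hrow f').2.2 (Finset.mem_filter.1 hf').2.symm
  by_cases hk2 : k = 2
  · refine le_trans (Finset.card_le_card_of_injOn (t := ((({(e (f.1 0)).1, (e (f.1 1)).1,
      (e (f.1 2)).1} : Finset (Fin l)) ×ˢ (Finset.univ : Finset (Fin k))).image e.symm)) _ ?_ hinj)
      ((Finset.card_image_le.trans ?_).trans (hc' hk2))
    · intro f' hf'
      have := hmem f' hf'
      simp only [Finset.coe_image, Set.mem_image]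
      refine ⟨e (f'.1 0), ?_, by simp⟩
      simp only [Finset.coe_product, Set.mem_prod, Finset.mem_coe, Finset.mem_insert,
        Finset.mem_singleton, Finset.mem_univ, and_true]
      grind
    · rw [Finset.card_product, Finset.card_univ, Fintype.card_fin]
      have := Finset.card_le_three (a := (e (f.1 0)).1) (b := (e (f.1 1)).1) (c := (e (f.1 2)).1)
      exact Nat.mul_le_mul this hk2.le
  · refine le_trans (Finset.card_le_card_of_injOn
      (t := ({f.1 0, f.1 1, f.1 2} : Finset (Fin (k * l)))) _ ?_ hinj)
      (Finset.card_le_three.trans hc)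
    intro f' hf'
    have := hmem f' hf'
    simp only [Finset.coe_insert, Finset.coe_singleton, Set.mem_insert_iff, Set.mem_singleton_iff]
    grind

lemma swap_smul_ne {k l : ℕ} (hk : 2 ≤ k) {P : partitionsSubMulAction k l} {x y : Fin (k * l)}
    (hxy : ¬ SamePart P x y) : Equiv.swap x y • P ≠ P := by
  obtain ⟨e, he⟩ := exists_isChart P
  obtain ⟨w, hw, hw'⟩ := IsChart.exists_ne hk e x
  intro h
  have h1 := samePart_swap_smul he x y x w
  rw [h, he] at h1
  rw [he] at hxy
  grind

lemma cycleThree_ne {k l : ℕ} (hk : 2 ≤ k) {P : partitionsSubMulAction k l}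
    {e : Fin (k * l) ≃ Fin l × Fin k} (he : IsChart e P) {x y z : Fin (k * l)}
    (hxy : (e x).1 ≠ (e y).1) (hyz : (e y).1 ≠ (e z).1) (hxz : (e x).1 ≠ (e z).1) :
    cycleThree P x y z ≠ P := by
  obtain ⟨w, hw, hw'⟩ := IsChart.exists_ne hk e x
  intro h
  have h1 := samePart_cycleThree he (ne_of_apply_ne (fun t => (e t).1) hxy)
    (ne_of_apply_ne (fun t => (e t).1) hyz) (ne_of_apply_ne (fun t => (e t).1) hxz) x w
  rw [h, he] at h1
  grind

lemma card_row {k l : ℕ} (e : Fin (k * l) ≃ Fin l × Fin k) (i : Fin l) :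
    (Finset.univ.filter fun x => (e x).1 = i).card = k := by
  have : (Finset.univ.filter fun x => (e x).1 = i) =
      Finset.univ.image fun j => e.symm (i, j) := by
    ext x
    simp only [Finset.mem_filter, Finset.mem_univ, true_and, Finset.mem_image]
    constructor
    · rintro rfl
      exact ⟨(e x).2, by simp⟩
    · rintro ⟨j, rfl⟩
      simp
  rw [this, Finset.card_image_of_injective _ fun j j' h => by simpa using h, Finset.card_univ,
    Fintype.card_fin]

lemma samePart_swap_smul_swap_smul {k : ℕ} {P : partitionsSubMulAction k 2}
    {e : Fin (k * 2) ≃ Fin 2 × Fin k} (he : IsChart e P) {s₁ s₂ t₁ t₂ : Fin (k * 2)}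
    (hs : s₁ ≠ s₂) (ht : t₁ ≠ t₂) (hs₁ : (e s₁).1 = 0) (hs₂ : (e s₂).1 = 0)
    (ht₁ : (e t₁).1 = 1) (ht₂ : (e t₂).1 = 1) (u v : Fin (k * 2)) :
    SamePart (Equiv.swap s₁ t₁ • Equiv.swap s₂ t₂ • P) u v ↔
      ((if u = s₁ ∨ u = s₂ then 1 else if u = t₁ ∨ u = t₂ then 0 else (e u).1) =
      (if v = s₁ ∨ v = s₂ then 1 else if v = t₁ ∨ v = t₂ then 0 else (e v).1)) := by
  have : ∀ u, (e ((Equiv.swap s₁ t₁ * Equiv.swap s₂ t₂)⁻¹ u)).1 =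
      if u = s₁ ∨ u = s₂ then 1 else if u = t₁ ∨ u = t₂ then 0 else (e u).1 := by
    intro u
    simp only [mul_inv_rev, Equiv.swap_inv, Equiv.Perm.mul_apply, Equiv.swap_apply_def]
    grind
  rw [← mul_smul, he.samePart_smul, this, this]

/-- For partitions into two parts, exchanging two pairs of points yields a large suborbit. -/
lemma exists_choose_mul_choose_le_card_suborbit {k : ℕ} (hk : 4 ≤ k)
    {G : Subgroup (Equiv.Perm (Fin (k * 2)))} (hG : alternatingGroup (Fin (k * 2)) ≤ G)
    (P : partitionsSubMulAction k 2) :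
    ∃ Q ≠ P, (k - 1).choose 2 * k.choose 2 ≤ Nat.card (suborbit G P Q) := by
  classical
  obtain ⟨e, he⟩ := exists_isChart P
  have hpt : ∀ (i : Fin 2) (n : Fin 4), ∃ x, e x = (i, Fin.castLE hk n) :=
    fun i n => e.surjective _
  choose pt hpt using hpt
  have hrow : ∀ i n, (e (pt i n)).1 = i := fun i n => by rw [hpt]
  have hinj : ∀ i n m, pt i n = pt i m → n = m := by
    intro i n m h
    have h' := congrArg e h
    rw [hpt, hpt] at h'
    simpa using h'
  have hne : ∀ i n m, n ≠ m → pt i n ≠ pt i m := fun i n m h h' => h (hinj i n m h')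
  have hne' : ∀ n m, pt 0 n ≠ pt 1 m := fun n m h => by
    have := congrArg (fun t => (e t).1) h
    simp [hrow] at this
  set Q₀ := Equiv.swap (pt 0 0) (pt 1 0) • Equiv.swap (pt 0 1) (pt 1 1) • P with hQ₀
  refine ⟨Q₀, ?_, ?_⟩
  · intro h
    have h1 := samePart_swap_smul_swap_smul he (hne 0 0 1 (by decide)) (hne 1 0 1 (by decide))
      (hrow _ _) (hrow _ _) (hrow _ _) (hrow _ _) (pt 0 0) (pt 0 2)
    rw [← hQ₀, h, he] at h1
    simp [hrow, hne 0 2 0 (by decide), hne 0 2 1 (by decide), hne'] at h1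
  set a := pt 0 0
  set A := Finset.univ.filter fun x => (e x).1 = 0
  set B := Finset.univ.filter fun x => (e x).1 = 1
  have ha : a ∈ A := by simp [A, a, hrow]
  set D := Finset.powersetCard 2 (A.erase a) ×ˢ Finset.powersetCard 2 B
  have hD : D.card = (k - 1).choose 2 * k.choose 2 := by
    rw [Finset.card_product, Finset.card_powersetCard, Finset.card_powersetCard,
      Finset.card_erase_of_mem ha, card_row, card_row]
  have hex : ∀ p ∈ D, ∃ Q ∈ suborbit G P Q₀, ∀ u, SamePart Q a u ↔ u ∈ p.2 ∨ (u ∈ A ∧ u ∉ p.1) := by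
    rintro ⟨S, T⟩ hp
    obtain ⟨hS, hT⟩ := Finset.mem_product.1 hp
    obtain ⟨hSA, hS2⟩ := Finset.mem_powersetCard.1 hS
    obtain ⟨hTB, hT2⟩ := Finset.mem_powersetCard.1 hT
    obtain ⟨s₁, s₂, hs, rfl⟩ := Finset.card_eq_two.1 hS2
    obtain ⟨t₁, t₂, ht, rfl⟩ := Finset.card_eq_two.1 hT2
    simp only [Finset.insert_subset_iff, Finset.singleton_subset_iff, Finset.mem_erase, A, B,
      Finset.mem_filter, Finset.mem_univ, true_and] at hSA hTB
    obtain ⟨⟨has₁, hs₁⟩, has₂, hs₂⟩ := hSA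
    obtain ⟨ht₁, ht₂⟩ := hTB
    have hst : ∀ {s t}, (e s).1 = 0 → (e t).1 = 1 → s ≠ t := by
      rintro s t h h' rfl
      simp [h] at h'
    obtain ⟨g, hgG, hgP, hg⟩ := exists_mem_smul_eq_of_samePart_iff (by omega) hG (P := P) (P' := P)
      ![pt 0 0, pt 0 1, pt 1 0, pt 1 1] ![s₁, s₂, t₁, t₂] (by
        intro i j
        fin_cases i <;> fin_cases j <;> simp [hne 0 0 1 (by decide), hne 0 1 0 (by decide),
          hne 1 0 1 (by decide), hne 1 1 0 (by decide), hs, ht, hs.symm, ht.symm, hne',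
          (hne' _ _).symm, hst hs₁ ht₁, hst hs₁ ht₂, hst hs₂ ht₁, hst hs₂ ht₂,
          (hst hs₁ ht₁).symm, (hst hs₁ ht₂).symm, (hst hs₂ ht₁).symm, (hst hs₂ ht₂).symm]) (by
        intro i j
        rw [he, he]
        fin_cases i <;> fin_cases j <;> simp [hrow, hs₁, hs₂, ht₁, ht₂])
      ⟨pt 0 2, pt 0 3, hne _ _ _ (by decide), (he _ _).2 (by rw [hrow, hrow]), by
        intro i
        fin_cases i <;> simp [hne 0 0 2 (by decide), hne 0 0 3 (by decide), hne 0 1 2 (by decide),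
          hne 0 1 3 (by decide), (hne' _ _).symm]⟩
    refine ⟨g • Q₀, mem_suborbit.2 ⟨g, hgG, hgP, rfl⟩, fun u => ?_⟩
    have h0 : g (pt 0 0) = s₁ := hg 0
    have h1 : g (pt 0 1) = s₂ := hg 1
    have h2 : g (pt 1 0) = t₁ := hg 2
    have h3 : g (pt 1 1) = t₂ := hg 3
    rw [hQ₀, smul_swap_smul (smul_swap_smul hgP _ _), h0, h1, h2, h3,
      samePart_swap_smul_swap_smul he hs ht hs₁ hs₂ ht₁ ht₂]
    have hA : ∀ u, u ∈ A ↔ (e u).1 = 0 := fun u => by simp [A]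
    have ha' := (hA a).1 ha
    have := hst ha' ht₁
    have := hst ha' ht₂
    simp only [Finset.mem_insert, Finset.mem_singleton, hA]
    grind
  have : Nonempty (partitionsSubMulAction k 2) := ⟨P⟩
  choose! Q hQ hQu using hex
  rw [← hD, ← Set.ncard_coe_finset]
  refine Set.ncard_le_ncard_of_injOn Q (fun p hp => hQ p hp) ?_ (Set.toFinite _)
  rintro ⟨S, T⟩ hp ⟨S', T'⟩ hp' h
  have h1 := fun u => (hQu _ hp u).symm.trans (h ▸ hQu _ hp' u)
  simp only [D, Finset.coe_product, Set.mem_prod, Finset.mem_coe, Finset.mem_powersetCard] at hp hp'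
  have hS : ∀ u ∈ S, u ∈ A := fun u hu => Finset.mem_of_mem_erase (hp.1.1 hu)
  have hS' : ∀ u ∈ S', u ∈ A := fun u hu => Finset.mem_of_mem_erase (hp'.1.1 hu)
  have hAB : ∀ u ∈ B, u ∉ A := by
    intro u hu hu'
    simp only [A, B, Finset.mem_filter, Finset.mem_univ, true_and] at hu hu'
    simp [hu] at hu'
  have hT : ∀ u ∈ T, u ∉ A := fun u hu => hAB u (hp.2.1 hu)
  have hT' : ∀ u ∈ T', u ∉ A := fun u hu => hAB u (hp'.2.1 hu)
  refine Prod.ext ?_ ?_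
  · ext u
    have := h1 u
    grind
  · ext u
    have := h1 u
    grind

lemma not_isThreeHalvesTransitive_of_three_le {k l : ℕ} (hk : 2 ≤ k) (hl : 3 ≤ l)
    {G : Subgroup (Equiv.Perm (Fin (k * l)))} (hG : alternatingGroup (Fin (k * l)) ≤ G)
    (P : partitionsSubMulAction k l) :
    ¬ IsThreeHalvesTransitive G (partitionsSubMulAction k l) := by
  rintro ⟨-, h⟩
  obtain ⟨s, -, hs⟩ := h P
  obtain ⟨e, he⟩ := exists_isChart P
  let f : Transversal P 3 := ⟨fun i => e.symm (Fin.castLE hl i, ⟨0, by omega⟩), fun i j h => by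
    rw [he] at h
    simpa using h⟩
  have hrow : ∀ i j, i ≠ j → (e (f.1 i)).1 ≠ (e (f.1 j)).1 :=
    fun i j hij h => hij (f.2 i j ((he _ _).2 h))
  have h01 : ¬ SamePart P (f.1 0) (f.1 1) := fun h => absurd (f.2 0 1 h) (by decide)
  have e1 : Nat.card (suborbit G P _) = s := hs _ (swap_smul_ne hk h01)
  have e2 : Nat.card (suborbit G P _) = s := hs _ (cycleThree_ne hk he (hrow 0 1 (by decide))
    (hrow 1 2 (by decide)) (hrow 0 2 (by decide)))
  obtain ⟨l, rfl⟩ : ∃ m, l = m + 3 := ⟨l - 3, by omega⟩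
  have hd : (l + 3).descFactorial 3 = (l + 1) * (l + 3).descFactorial 2 := by
    simp [Nat.descFactorial_succ]
  have hpos : 0 < (l + 3).descFactorial 2 := Nat.descFactorial_pos.2 (by omega)
  generalize hdd : (l + 3).descFactorial 2 = d at *
  by_cases hk2 : k = 2
  · have u := mul_card_suborbit_swap_le hk G h01 (c := 4) (Or.inr ⟨hk2, le_rfl⟩)
    have v := le_mul_card_suborbit_cycleThree hk hG f (c := 6) (by norm_num) fun _ => le_rfl
    rw [e1, hdd] at u
    rw [e2, hd] at v
    have hk3 : k ^ 2 = 4 ∧ k ^ 3 = 8 := by rw [hk2]; norm_num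
    rw [hk3.1] at u
    rw [hk3.2] at v
    nlinarith [Nat.zero_le (l * d)]
  · have u := mul_card_suborbit_swap_le hk G h01 (c := 2) (Or.inl le_rfl)
    have v := le_mul_card_suborbit_cycleThree hk hG f (c := 3) le_rfl fun h => absurd h hk2
    rw [e1, hdd] at u
    rw [e2, hd] at v
    have hk3 : 3 ≤ k := by omega
    have h1 : d * k ^ 2 * 3 ≤ d * k ^ 2 * k := Nat.mul_le_mul_left _ hk3
    have h2 : 0 < d * k ^ 2 := by positivity
    have h3 : (l + 1) * d * k ^ 3 = l * d * k ^ 3 + d * k ^ 2 * k := by ring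
    have h4 := Nat.zero_le (l * d * k ^ 3)
    omega

lemma not_isThreeHalvesTransitive_of_eq_two {k : ℕ} (hk : 4 ≤ k)
    {G : Subgroup (Equiv.Perm (Fin (k * 2)))} (hG : alternatingGroup (Fin (k * 2)) ≤ G)
    (P : partitionsSubMulAction k 2) :
    ¬ IsThreeHalvesTransitive G (partitionsSubMulAction k 2) := by
  rintro ⟨-, h⟩
  obtain ⟨s, -, hs⟩ := h P
  obtain ⟨e, he⟩ := exists_isChart P
  obtain ⟨Q, hQP, hQ⟩ := exists_choose_mul_choose_le_card_suborbit hk hG P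
  have h01 : ¬ SamePart P (e.symm (0, ⟨0, by omega⟩)) (e.symm (1, ⟨0, by omega⟩)) := by
    rw [he]; simp
  have e1 : Nat.card (suborbit G P _) = s := hs _ (swap_smul_ne (by omega) h01)
  have e2 : Nat.card (suborbit G P Q) = s := hs _ hQP
  have u := mul_card_suborbit_swap_le (by omega) G h01 (c := 2) (Or.inl le_rfl)
  rw [e1] at u
  rw [e2] at hQ
  have hd : Nat.descFactorial 2 2 = 2 := by decide
  rw [hd] at u
  obtain ⟨m, rfl⟩ : ∃ m, k = m + 4 := ⟨k - 4, by omega⟩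
  have c3 : (m + 4 - 1).choose 2 * 2 = (m + 3) * (m + 2) := by
    have := Nat.descFactorial_eq_factorial_mul_choose (m + 3) 2
    simp [Nat.descFactorial_succ] at this
    simp only [show m + 4 - 1 = m + 3 from rfl]
    linarith
  have c4 : (m + 4).choose 2 * 2 = (m + 4) * (m + 3) := by
    have := Nat.descFactorial_eq_factorial_mul_choose (m + 4) 2
    simp [Nat.descFactorial_succ] at this
    linarith
  have c5 : ((m + 4 - 1).choose 2 * (m + 4).choose 2) * 4 =
      ((m + 3) * (m + 2)) * ((m + 4) * (m + 3)) := by rw [← c3, ← c4]; ring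
  have c6 : ((m + 3) * (m + 2)) * ((m + 4) * (m + 3)) ≤ 4 * (m + 4) ^ 2 := by linarith
  have c7 : (m + 4) * ((m + 3) * (m + 3) * (m + 2)) ≤ (m + 4) * (4 * (m + 4)) := by
    calc _ = _ := by ring
      _ ≤ _ := c6
      _ = _ := by ring
  have c8 := Nat.le_of_mul_le_mul_left c7 (by omega)
  nlinarith [Nat.zero_le (m ^ 3), Nat.zero_le (m ^ 2)]

lemma nonempty_partitions {k l : ℕ} (hk : 0 < k) : Nonempty (partitionsSubMulAction k l) := by
  classical
  let e : Fin (k * l) ≃ Fin l × Fin k := (finCongr (mul_comm k l)).trans finProdFinEquiv.symm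
  let row : Fin l → Finset (Fin (k * l)) := fun i => Finset.univ.filter fun x => (e x).1 = i
  have hinj : Function.Injective row := by
    intro i j h
    have : e.symm (i, ⟨0, hk⟩) ∈ row j := by
      rw [← h]
      simp [row]
    simpa [row] using this
  refine ⟨⟨Finset.univ.image row, ?_, ?_, fun x => ⟨row (e x).1, ⟨?_, ?_⟩, ?_⟩⟩⟩
  · intro s hs
    obtain ⟨i, -, rfl⟩ := Finset.mem_image.1 hs
    exact card_row e i
  · rw [Finset.card_image_of_injective _ hinj, Finset.card_univ, Fintype.card_fin]
  · exact Finset.mem_image_of_mem _ (Finset.mem_univ _)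
  · simp [row]
  · rintro s ⟨hs, hx⟩
    obtain ⟨i, -, rfl⟩ := Finset.mem_image.1 hs
    simp only [row, Finset.mem_filter, Finset.mem_univ, true_and] at hx
    rw [hx]

lemma coloring_two_by_three (w : Fin 2 × Fin 3 → Fin 2)
    (hw : (Finset.univ.filter fun p => w p = 0).card = 3) :
    (∀ u v, w u = w v ↔ u.1 = v.1) ∨ ∃ x y : Fin 2 × Fin 3, x.1 ≠ y.1 ∧ ∀ u v, w u = w v ↔
      (if u = x then y.1 else if u = y then x.1 else u.1) =
      (if v = x then y.1 else if v = y then x.1 else v.1) := by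
  have key : ∀ a b c d e f : Fin 2, let w : Fin 2 × Fin 3 → Fin 2 :=
      fun p => ![![a, b, c], ![d, e, f]] p.1 p.2
      (Finset.univ.filter fun p => w p = 0).card = 3 →
      (∃ t, ∀ u, w u = u.1 + t) ∨ ∃ j j' : Fin 3, ∃ t, ∀ u, w u =
        (if u = (0, j) then 1 else if u = (1, j') then 0 else u.1) + t := by
    decide
  have hw' : ∀ p : Fin 2 × Fin 3, ![![w (0, 0), w (0, 1), w (0, 2)],
      ![w (1, 0), w (1, 1), w (1, 2)]] p.1 p.2 = w p := by
    rintro ⟨i, j⟩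
    fin_cases i <;> fin_cases j <;> rfl
  have h := key (w (0, 0)) (w (0, 1)) (w (0, 2)) (w (1, 0)) (w (1, 1)) (w (1, 2))
  simp only [hw'] at h
  rcases h hw with ⟨t, ht⟩ | ⟨j, j', t, ht⟩
  · exact Or.inl fun u v => by rw [ht, ht, add_left_inj]
  · exact Or.inr ⟨(0, j), (1, j'), zero_ne_one, fun u v => by rw [ht, ht, add_left_inj]⟩

/-- Distinct partitions of a `6`-set into two triples differ by a transposition. -/
lemma exists_swap_smul_eq {P Q : partitionsSubMulAction 3 2} (h : P ≠ Q) :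
    ∃ x y, ¬ SamePart P x y ∧ Equiv.swap x y • P = Q := by
  obtain ⟨e, he⟩ := exists_isChart P
  obtain ⟨e', he'⟩ := exists_isChart Q
  have hcard : (Finset.univ.filter fun p => (e' (e.symm p)).1 = 0).card = 3 := by
    refine Eq.trans ?_ (card_row e' 0)
    exact Finset.card_equiv e.symm fun p => by simp
  rcases coloring_two_by_three _ hcard with hw | ⟨x, y, hxy, hw⟩
  · refine absurd (partition_ext (by norm_num) fun u v => ?_) h
    rw [he, he']
    simpa using (hw (e u) (e v)).symm
  · refine ⟨e.symm x, e.symm y, by rw [he]; simpa using hxy,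
      partition_ext (by norm_num) fun u v => ?_⟩
    rw [samePart_swap_smul he, he']
    have := (hw (e u) (e v)).symm
    simpa [Equiv.eq_symm_apply] using this

lemma isTwoTransitive_three_two {G : Subgroup (Equiv.Perm (Fin (3 * 2)))}
    (hG : alternatingGroup (Fin (3 * 2)) ≤ G) :
    IsTwoTransitive G (partitionsSubMulAction 3 2) := by
  intro a b c d hab hcd
  obtain ⟨x, y, hxy, rfl⟩ := exists_swap_smul_eq hab
  obtain ⟨x', y', hxy', rfl⟩ := exists_swap_smul_eq hcd
  obtain ⟨e, he⟩ := exists_isChart a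
  obtain ⟨u, hu, hu'⟩ := IsChart.exists_ne (by norm_num) e x
  obtain ⟨v, hv, hv', hv2⟩ := IsChart.exists_ne_ne (by norm_num) e x u
  have hne : ∀ {P : partitionsSubMulAction 3 2} {x y}, ¬ SamePart P x y →
      ¬ SamePart P y x ∧ x ≠ y ∧ y ≠ x := fun {P x y} h =>
    ⟨fun h' => h (samePart_comm.1 h'), fun h' => h (h' ▸ samePart_refl _ _),
      fun h' => h (h' ▸ samePart_refl _ _)⟩
  obtain ⟨g, hgG, hgP, hg⟩ := exists_mem_smul_eq_of_samePart_iff (by norm_num) hG (P := a)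
    (P' := c) ![x, y] ![x', y'] (by
      intro i j
      fin_cases i <;> fin_cases j <;> simp [hne hxy, hne hxy']) (by
      intro i j
      fin_cases i <;> fin_cases j <;> simp [hne hxy, hne hxy', hxy, hxy', samePart_refl])
    ⟨u, v, hv'.symm, (he _ _).2 (hu'.trans hv2.symm), by
      rw [he] at hxy
      intro i
      fin_cases i
      · exact ⟨hu.symm, hv.symm⟩
      · exact ⟨by rintro rfl; exact hxy hu'.symm, by rintro rfl; exact hxy hv2.symm⟩⟩
  refine ⟨⟨g, hgG⟩, hgP, ?_⟩
  have h0 : g x = x' := hg 0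
  have h1 : g y = y' := hg 1
  change g • Equiv.swap x y • a = _
  rw [smul_swap_smul hgP, h0, h1]

lemma IsTwoTransitive.isThreeHalvesTransitive {G Ω : Type*} [Group G] [MulAction G Ω] [Finite Ω]
    (h : IsTwoTransitive G Ω) (h3 : ∀ a : Ω, ∃ b c, b ≠ a ∧ c ≠ a ∧ b ≠ c) :
    IsThreeHalvesTransitive G Ω := by
  refine ⟨⟨fun a b => ?_⟩, fun a => ⟨Nat.card ({a}ᶜ : Set Ω), ?_, fun b hb => ?_⟩⟩
  · obtain ⟨a', -, ha', -, -⟩ := h3 a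
    obtain ⟨b', -, hb', -, -⟩ := h3 b
    obtain ⟨g, hg, -⟩ := h a a' b b' ha'.symm hb'.symm
    exact ⟨g, hg⟩
  · obtain ⟨b, c, hb, hc, hbc⟩ := h3 a
    exact (Set.one_lt_ncard (Set.toFinite _)).2 ⟨b, hb, c, hc, hbc⟩
  · congr 1
    have : MulAction.orbit (MulAction.stabilizer G a) b = {a}ᶜ := by
      ext c
      constructor
      · rintro ⟨⟨g, hg⟩, rfl⟩ hc
        have hc' : g • b = g • a := by
          rw [MulAction.mem_stabilizer_iff.1 hg]
          exact hc
        exact hb (MulAction.injective g hc')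
      · intro hc
        obtain ⟨g, hga, hgb⟩ := h a b a c hb.symm (Ne.symm hc)
        exact ⟨⟨g, hga⟩, hgb⟩
    rw [this]

lemma exists_two_ne {k l : ℕ} (hk : 3 ≤ k) (hl : 2 ≤ l) (P : partitionsSubMulAction k l) :
    ∃ Q R, Q ≠ P ∧ R ≠ P ∧ Q ≠ R := by
  obtain ⟨e, he⟩ := exists_isChart P
  set x := e.symm (⟨0, by omega⟩, ⟨0, by omega⟩) with hx
  set y := e.symm (⟨1, by omega⟩, ⟨0, by omega⟩) with hy
  have hxy : (e x).1 ≠ (e y).1 := by simp [hx, hy]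
  obtain ⟨z, hz, hz'⟩ := IsChart.exists_ne (by omega) e y
  refine ⟨Equiv.swap x y • P, Equiv.swap x z • P, swap_smul_ne (by omega) (by rwa [he]),
    swap_smul_ne (by omega) (by rwa [he, hz']), fun h => ?_⟩
  obtain ⟨w, hw, hw', hw2⟩ := IsChart.exists_ne_ne hk e y z
  have h1 := samePart_swap_smul he x y w z
  have h2 := samePart_swap_smul he x z w z
  rw [h] at h1
  grind

/-- Lemma 4.3: for `G = A_{kl}` or `S_{kl}` (`k, l ≥ 2`, `kl ≥ 5`) acting on the set
of partitions of a `kl`-set into `l` parts of size `k`, `G` is `3/2`-transitive iff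
`(k,l) = (3,2)`, and in that case `G` is in fact 2-transitive. -/
theorem stmt10 (k l : ℕ) (hk : 2 ≤ k) (hl : 2 ≤ l) (h5 : 5 ≤ k * l)
    (G : Subgroup (Equiv.Perm (Fin (k * l))))
    (hG : G = alternatingGroup (Fin (k * l)) ∨ G = ⊤) :
    (IsThreeHalvesTransitive G (partitionsSubMulAction k l) ↔ (k = 3 ∧ l = 2)) ∧
    ((k = 3 ∧ l = 2) → IsTwoTransitive G (partitionsSubMulAction k l)) := by
  have hAG : alternatingGroup (Fin (k * l)) ≤ G := by
    rcases hG with rfl | rfl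
    · exact le_rfl
    · exact le_top
  have h2 : (k = 3 ∧ l = 2) → IsTwoTransitive G (partitionsSubMulAction k l) := by
    rintro ⟨rfl, rfl⟩
    exact isTwoTransitive_three_two hAG
  refine ⟨⟨fun h => ?_, fun h => ?_⟩, h2⟩
  · obtain ⟨P⟩ := nonempty_partitions (k := k) (l := l) (by omega)
    rcases hl.eq_or_lt with rfl | hl3
    · by_contra hc
      exact not_isThreeHalvesTransitive_of_eq_two (by omega) hAG P h
    · exact absurd h (not_isThreeHalvesTransitive_of_three_le hk hl3 hAG P)
  · exact (h2 h).isThreeHalvesTransitive (exists_two_ne (by omega) hl)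
end

section
/- Every finite primitive 3/2-transitive permutation group is either of affine type (has an elementary abelian regular normal subgroup) or almost simple (has a unique minimal normal subgroup which is nonabelian simple). -/
/-- A group action is primitive if it is transitive and every block is trivial. -/
def IsPrimitiveAction (G Ω : Type*) [Group G] [MulAction G Ω] : Prop :=
  MulAction.IsPretransitive G Ω ∧
    ∀ B : Set Ω, MulAction.IsBlock G B → B.Subsingleton ∨ B = Set.univ

section

open scoped Pointwise

/-! ### Orbits of equal size -/

/-- If a group fixes a point and all its other orbits have size `s`, then `s` is coprime to
the number of points. -/
theorem coprime_card_of_orbits_eq {H Ω : Type*} [Group H] [Finite Ω] [MulAction H Ω] {α : Ω}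
    {s : ℕ} (hα : ∀ h : H, h • α = α)
    (hs : ∀ β, β ≠ α → Nat.card (MulAction.orbit H β) = s) : s.Coprime (Nat.card Ω) := by
  classical
  have : Fintype (MulAction.orbitRel.Quotient H Ω) := Fintype.ofFinite _
  have hsum : Nat.card Ω = ∑ ω : MulAction.orbitRel.Quotient H Ω,
      Nat.card (MulAction.orbit H ω.out) := by
    rw [Nat.card_congr (MulAction.selfEquivSigmaOrbits H Ω), Nat.card_sigma]
  have hone : Nat.card (MulAction.orbit H α) = 1 := by
    rw [Nat.card_eq_one_iff_unique]
    refine ⟨⟨?_⟩, ⟨⟨α, MulAction.mem_orbit_self α⟩⟩⟩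
    rintro ⟨_, h, rfl⟩ ⟨_, k, rfl⟩
    simp [hα]
  let ω₀ : MulAction.orbitRel.Quotient H Ω := Quotient.mk'' α
  have hout : ∀ ω : MulAction.orbitRel.Quotient H Ω, ω.out = α ↔ ω = ω₀ := by
    intro ω
    constructor
    · intro h
      rw [← Quotient.out_eq ω, h]
    · rintro rfl
      have h : (ω₀.out) ∈ MulAction.orbit H α := by
        rw [← MulAction.orbitRel_apply]
        exact Quotient.exact (Quotient.out_eq ω₀)
      obtain ⟨k, hk⟩ := h
      rw [← hk]
      exact hα k
  rw [← Finset.add_sum_erase _ _ (Finset.mem_univ ω₀), (hout ω₀).2 rfl, hone,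
    Finset.sum_congr rfl (g := fun _ => s)
      (fun ω hω => hs _ fun h => Finset.ne_of_mem_erase hω ((hout ω).1 h))] at hsum
  rw [hsum, Finset.sum_const, smul_eq_mul]
  simp

/-- The orbits of a normal subgroup have sizes dividing those of the whole group. -/
theorem Subgroup.relIndex_dvd_index_of_right_normal {H : Type*} [Group H] [Finite H]
    (Z K : Subgroup H) [K.Normal] : Z.relIndex K ∣ Z.index := by
  refine dvd_trans (dvd_of_eq ?_) (Subgroup.relIndex_dvd_index_of_le (le_sup_left : Z ≤ Z ⊔ K))
  have h1 := Subgroup.card_mul_index (Z.subgroupOf K)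
  have h2 := Subgroup.card_mul_index (K.subgroupOf Z)
  have h3 := Subgroup.card_mul_index (K.subgroupOf (Z ⊔ K))
  have h4 := Subgroup.card_mul_index (Z.subgroupOf (Z ⊔ K))
  change _ * Z.relIndex K = _ at h1
  change _ * K.relIndex Z = _ at h2
  change _ * K.relIndex (Z ⊔ K) = _ at h3
  change _ * Z.relIndex (Z ⊔ K) = _ at h4
  rw [Nat.card_congr (Subgroup.subgroupOfEquivOfLe le_sup_left).toEquiv] at h4
  rw [Nat.card_congr (Subgroup.subgroupOfEquivOfLe le_sup_right).toEquiv,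
    Subgroup.relIndex_sup_right] at h3
  have h5 : Nat.card (Z.subgroupOf K) = Nat.card (K.subgroupOf Z) := by
    rw [← Subgroup.inf_subgroupOf_right Z K, ← Subgroup.inf_subgroupOf_left K Z,
      Nat.card_congr (Subgroup.subgroupOfEquivOfLe inf_le_right).toEquiv,
      Nat.card_congr (Subgroup.subgroupOfEquivOfLe inf_le_left).toEquiv]
  apply Nat.eq_of_mul_eq_mul_left (Nat.card_pos (α := Z))
  rw [h4, ← h3, ← h1, ← h2, h5]
  ring

/-- The orbits of a normal subgroup have sizes dividing those of the whole group. -/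
theorem Subgroup.relIndex_dvd_relIndex_of_normalizes {G : Type*} [Group G] [Finite G]
    {H K : Subgroup G} (Z : Subgroup G) (hKH : K ≤ H)
    (hn : ∀ h ∈ H, ∀ k ∈ K, h * k * h⁻¹ ∈ K) : Z.relIndex K ∣ Z.relIndex H := by
  have hK : (K.subgroupOf H).Normal := ⟨fun k hk h => hn h h.2 k hk⟩
  rw [← Subgroup.relIndex_subgroupOf hKH]
  exact Subgroup.relIndex_dvd_index_of_right_normal _ _

theorem card_orbit_eq_relIndex {G Ω : Type*} [Group G] [MulAction G Ω] (H : Subgroup G) (β : Ω) :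
    Nat.card (MulAction.orbit H β) = (MulAction.stabilizer G β).relIndex H := by
  rw [Subgroup.relIndex, Nat.card_coe_set_eq, ← MulAction.index_stabilizer]
  rfl

/-! ### Fixed-point-free actions -/

/-- If every nontrivial element of a group fixes exactly one point, then the group has a
fixed point. -/
theorem exists_fixedPoint_of_existsUnique {Q X : Type*} [Group Q] [Finite Q] [Finite X] [Nonempty X]
    [MulAction Q X] (h : ∀ q : Q, q ≠ 1 → ∃! x : X, q • x = x) : ∃ x : X, ∀ q : Q, q • x = x := by
  classical
  have : Fintype Q := Fintype.ofFinite _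
  have : Fintype X := Fintype.ofFinite _
  have : Fintype (MulAction.orbitRel.Quotient Q X) := Fintype.ofFinite _
  by_contra! hno
  have hburn := MulAction.sum_card_fixedBy_eq_card_orbits_mul_card_group Q X
  rw [← Finset.add_sum_erase _ _ (Finset.mem_univ (1 : Q)),
    Finset.sum_congr rfl (g := fun _ => 1) (fun q hq => by
      obtain ⟨x, hx, hu⟩ := h q (Finset.ne_of_mem_erase hq)
      rw [Fintype.card_eq_one_iff]
      exact ⟨⟨x, hx⟩, fun y => Subtype.ext (hu y y.2)⟩)] at hburn
  have hcX : Nat.card X = ∑ ω : MulAction.orbitRel.Quotient Q X,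
      Nat.card (MulAction.orbit Q ω.out) := by
    rw [Nat.card_congr (MulAction.selfEquivSigmaOrbits Q X), Nat.card_sigma]
  have hdvd : ∀ x : X, Nat.card (MulAction.orbit Q x) ∣ Fintype.card Q := by
    intro x
    rw [Nat.card_coe_set_eq, ← MulAction.index_stabilizer, ← Nat.card_eq_fintype_card]
    exact Subgroup.index_dvd_card _
  have hne : ∀ x : X, Nat.card (MulAction.orbit Q x) ≠ 1 := by
    intro x hx
    rw [Nat.card_eq_one_iff_unique] at hx
    obtain ⟨q, hq⟩ := hno x
    have := hx.1.elim ⟨q • x, q, rfl⟩ ⟨x, MulAction.mem_orbit_self x⟩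
    exact hq (congrArg Subtype.val this)
  have hhalf : ∀ x : X, Nat.card (MulAction.orbit Q x) = Fintype.card Q ∨
      2 * Nat.card (MulAction.orbit Q x) ≤ Fintype.card Q := by
    intro x
    obtain ⟨c, hc⟩ := hdvd x
    have : 0 < Fintype.card Q := Fintype.card_pos
    rcases Nat.lt_or_ge c 2 with h2 | h2
    · interval_cases c
      · omega
      · left; omega
    · right; nlinarith
  have h1 : Fintype.card ↑(MulAction.fixedBy X (1 : Q)) = Nat.card X := by
    rw [← Nat.card_eq_fintype_card]
    exact Nat.card_congr (Equiv.subtypeUnivEquiv fun x => one_smul Q x)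
  rw [h1, hcX] at hburn
  have hpos : 0 < Fintype.card Q := Fintype.card_pos
  have hQ1 : 1 < Fintype.card Q := by
    obtain ⟨x⟩ := ‹Nonempty X›
    obtain ⟨q, hq⟩ := hno x
    rw [Fintype.one_lt_card_iff]
    exact ⟨q, 1, fun h => hq (by rw [h, one_smul])⟩
  have hsum : ∑ ω : MulAction.orbitRel.Quotient Q X,
      (Fintype.card Q - Nat.card (MulAction.orbit Q ω.out)) = Fintype.card Q - 1 := by
    have : ∑ ω : MulAction.orbitRel.Quotient Q X,
      (Fintype.card Q - Nat.card (MulAction.orbit Q ω.out)) +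
      ∑ ω : MulAction.orbitRel.Quotient Q X, Nat.card (MulAction.orbit Q ω.out) =
      Fintype.card (MulAction.orbitRel.Quotient Q X) * Fintype.card Q := by
      rw [← Finset.sum_add_distrib, Finset.sum_congr rfl (g := fun _ => Fintype.card Q)
        (fun ω _ => Nat.sub_add_cancel (Nat.le_of_dvd hpos (hdvd _)))]
      simp
    change _ = Fintype.card (MulAction.orbitRel.Quotient Q X) * Fintype.card Q at hburn
    simp only [Finset.sum_const, Finset.card_erase_of_mem (Finset.mem_univ (1 : Q)),
      Finset.card_univ, smul_eq_mul, mul_one] at hburn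
    omega
  obtain ⟨ω₀, -, h0⟩ := Finset.exists_ne_zero_of_sum_ne_zero (by rw [hsum]; omega)
  rw [← Finset.add_sum_erase _ _ (Finset.mem_univ ω₀)] at hsum
  have hω₀ := hhalf ω₀.out
  have hω₀' := hne ω₀.out
  have hrest : ∑ ω ∈ Finset.univ.erase ω₀,
      (Fintype.card Q - Nat.card (MulAction.orbit Q ω.out)) ≠ 0 := by
    have := Nat.le_of_dvd hpos (hdvd ω₀.out)
    have : 0 < Nat.card (MulAction.orbit Q ω₀.out) := Nat.pos_of_dvd_of_pos (hdvd _) hpos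
    omega
  obtain ⟨ω₁, hm, h1⟩ := Finset.exists_ne_zero_of_sum_ne_zero hrest
  rw [← Finset.add_sum_erase _ _ hm] at hsum
  have hω₁ := hhalf ω₁.out
  omega

/-- If a finite group acts on a finite group by automorphisms without nontrivial fixed points,
then it leaves a Sylow `p`-subgroup invariant. -/
theorem exists_sylow_fixed_of_fixedPointFree {Q N : Type*} [Group Q] [Finite Q] [Group N]
    [Finite N] [MulDistribMulAction Q N] (h : ∀ q : Q, q ≠ 1 → ∀ x : N, q • x = x → x = 1)
    (p : ℕ) [Fact p.Prime] : ∃ P : Sylow p N, ∀ q : Q, q • P = P := by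
  apply exists_fixedPoint_of_existsUnique
  intro q hq
  have hinj : Function.Injective fun x : N => x⁻¹ * q • x := by
    intro x y hxy
    have hxy' : x⁻¹ * q • x = y⁻¹ * q • y := hxy
    have := h q hq (y * x⁻¹) (by
      rw [smul_mul', smul_inv']
      calc q • y * (q • x)⁻¹ = y * (y⁻¹ * q • y) * (q • x)⁻¹ := by group
        _ = y * x⁻¹ := by rw [← hxy']; group)
    exact (mul_inv_eq_one.1 this).symm
  have hsurj := Finite.surjective_of_injective hinj
  have hcompat : ∀ (x : N) (P : Sylow p N), q • (x • P) = (q • x) • (q • P) := by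
    intro x P
    apply Sylow.ext
    rw [Sylow.smul_def, Sylow.smul_def, Sylow.pointwise_smul_def, Sylow.pointwise_smul_def,
      Sylow.pointwise_smul_def, Sylow.pointwise_smul_def]
    ext z
    simp only [Subgroup.mem_pointwise_smul_iff_inv_smul_mem, ← map_inv, MulAut.smul_def,
      MulAut.conj_apply, smul_mul', smul_inv', inv_smul_smul, inv_inv]
  obtain ⟨P⟩ : Nonempty (Sylow p N) := inferInstance
  obtain ⟨g, hg⟩ := MulAction.exists_smul_eq N P (q • P)
  obtain ⟨x, hx⟩ := hsurj g⁻¹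
  have hxP : q • (x • P) = x • P := by
    rw [hcompat, ← hg, ← mul_smul]
    congr 1
    have hx' : x⁻¹ * q • x = g⁻¹ := hx
    rw [eq_inv_iff_mul_eq_one, mul_assoc, inv_mul_eq_one] at hx'
    exact hx'.symm
  refine ⟨x • P, hxP, fun P' hP' => ?_⟩
  generalize x • P = P₁ at hxP
  have hP'' : q • P' = P' := hP'
  obtain ⟨y, rfl⟩ := MulAction.exists_smul_eq N P₁ P'
  have hS : ∀ z ∈ MulAction.stabilizer N P₁, z⁻¹ * q • z ∈ MulAction.stabilizer N P₁ := by
    intro z hz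
    refine mul_mem (inv_mem hz) ?_
    rw [MulAction.mem_stabilizer_iff] at hz ⊢
    have := hcompat z P₁
    rwa [hz, hxP, eq_comm] at this
  have hy : y⁻¹ * q • y ∈ MulAction.stabilizer N P₁ := by
    rw [MulAction.mem_stabilizer_iff, mul_smul]
    have := hcompat y P₁
    rw [hP'', hxP] at this
    rw [← this, inv_smul_smul]
  have hsurj' := Finite.surjective_of_injective
    (f := fun z : MulAction.stabilizer N P₁ =>
      (⟨(z : N)⁻¹ * q • (z : N), hS z z.2⟩ : MulAction.stabilizer N P₁))
    (fun a b hab => Subtype.ext (hinj (congrArg Subtype.val hab)))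
  obtain ⟨z, hz⟩ := hsurj' ⟨_, hy⟩
  have : (z : N) = y := hinj (congrArg Subtype.val hz)
  rw [← this]
  exact z.2

/-- In a finite group without proper nontrivial normal subgroups, an abelian self-normalizing
Sylow subgroup is trivial or everything. -/
theorem Sylow.eq_bot_or_eq_top_of_self_normalizing {T : Type*} [Group T] [Finite T] {p : ℕ}
    [Fact p.Prime] (hT : ∀ M : Subgroup T, M.Normal → M = ⊥ ∨ M = ⊤) (P : Sylow p T)
    (hP : ∀ x ∈ P, ∀ y ∈ P, x * y = y * x) (hN : Subgroup.normalizer (P : Set T) ≤ P) :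
    (P : Subgroup T) = ⊥ ∨ (P : Subgroup T) = ⊤ := by
  have hc : Subgroup.normalizer (P : Set T) ≤ Subgroup.centralizer (P : Set T) := by
    intro x hx
    rw [Subgroup.mem_centralizer_iff]
    exact fun y hy => hP y hy x (hN hx)
  have hcompl := MonoidHom.ker_transferSylow_isComplement' P hc
  rcases hT _ (MonoidHom.normal_ker (MonoidHom.transferSylow P hc)) with h | h
  · rw [h, Subgroup.isComplement'_bot_left] at hcompl
    exact Or.inr hcompl
  · rw [h, Subgroup.isComplement'_top_left] at hcompl
    exact Or.inl hcompl

/-! ### The factors of a minimal normal subgroup -/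

/-- A conjugacy class `𝒯` of subgroups of `G` which are minimal among the nontrivial subgroups
normalized by `N`, pairwise commute, and of which `N` is the direct product. -/
structure IsFactorFamily {G : Type*} [Group G] (N : Subgroup G) (𝒯 : Set (Subgroup G)) : Prop where
  nonempty : 𝒯.Nonempty
  conj_mem : ∀ A ∈ 𝒯, ∀ g : G, MulAut.conj g • A ∈ 𝒯
  le : ∀ A ∈ 𝒯, A ≤ N
  ne_bot : ∀ A ∈ 𝒯, A ≠ ⊥
  normalized : ∀ A ∈ 𝒯, ∀ n ∈ N, ∀ a ∈ A, n * a * n⁻¹ ∈ A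
  minimal : ∀ A ∈ 𝒯, ∀ B ≤ A, B ≠ ⊥ → (∀ n ∈ N, ∀ b ∈ B, n * b * n⁻¹ ∈ B) → B = A
  conj_trans : ∀ A ∈ 𝒯, ∀ B ∈ 𝒯, ∃ g : G, MulAut.conj g • A = B
  generate : ∀ X : Subgroup G, (∀ A ∈ 𝒯, A ≤ X) → N ≤ X
  commute : ∀ A ∈ 𝒯, ∀ B ∈ 𝒯, A ≠ B → ∀ a ∈ A, ∀ b ∈ B, a * b = b * a
  disjoint : ∀ A ∈ 𝒯, ∀ a ∈ A, (∀ b ∈ A, a * b = b * a) → a = 1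

namespace IsFactorFamily

variable {G : Type*} [Group G] {N : Subgroup G} {𝒯 : Set (Subgroup G)}

theorem conj_apply_mem {A : Subgroup G} (g : G) {a : G} (ha : a ∈ A) :
    g * a * g⁻¹ ∈ MulAut.conj g • A :=
  Subgroup.smul_mem_pointwise_smul a (MulAut.conj g) A ha

theorem mem_conj_iff {A : Subgroup G} {g x : G} :
    x ∈ MulAut.conj g • A ↔ g⁻¹ * x * g ∈ A := by
  rw [Subgroup.mem_pointwise_smul_iff_inv_smul_mem, ← map_inv, MulAut.smul_def,
    MulAut.conj_apply, inv_inv]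

/-- A minimal normal subgroup with trivial centralizer is a product of a factor family. -/
theorem exists_of_minimal [Finite G] [N.Normal] (hN : N ≠ ⊥)
    (hmin : ∀ M : Subgroup G, M.Normal → M ≠ ⊥ → M ≤ N → M = N)
    (hcent : ∀ x : G, (∀ n ∈ N, x * n = n * x) → x = 1) : ∃ 𝒯, IsFactorFamily N 𝒯 := by
  have hfin : {A : Subgroup G | A ≤ N ∧ A ≠ ⊥ ∧ ∀ n ∈ N, ∀ a ∈ A, n * a * n⁻¹ ∈ A}.Finite :=
    Set.toFinite _
  have hnN : ∀ g : G, ∀ n ∈ N, g * n * g⁻¹ ∈ N := fun g n hn => Subgroup.Normal.conj_mem ‹_› n hn g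
  obtain ⟨T, ⟨hTN, hT1, hTn⟩, hTmin⟩ := hfin.exists_minimal
    ⟨N, le_rfl, hN, fun n hn a ha => hnN n a ha⟩
  have hTmin' : ∀ B : Subgroup G, B ≤ T → B ≠ ⊥ → (∀ n ∈ N, ∀ b ∈ B, n * b * n⁻¹ ∈ B) → B = T :=
    fun B hB hB1 hBn => le_antisymm hB (hTmin ⟨hB.trans hTN, hB1, hBn⟩ hB)
  let 𝒯 : Set (Subgroup G) := Set.range fun g : G => MulAut.conj g • T
  have conj_mem : ∀ A ∈ 𝒯, ∀ g : G, MulAut.conj g • A ∈ 𝒯 := by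
    rintro _ ⟨k, rfl⟩ g
    exact ⟨g * k, by simp only [map_mul, mul_smul]⟩
  have hle : ∀ A ∈ 𝒯, A ≤ N := by
    rintro _ ⟨k, rfl⟩ x hx
    rw [mem_conj_iff] at hx
    have := hnN k _ (hTN hx)
    group at this
    exact this
  have hbot : ∀ A ∈ 𝒯, A ≠ ⊥ := by
    rintro _ ⟨k, rfl⟩ h
    refine hT1 ((Subgroup.eq_bot_iff_forall _).2 fun x hx => ?_)
    have hx' := conj_apply_mem k hx
    change _ ∈ (fun g : G => MulAut.conj g • T) k at hx'
    rw [h, Subgroup.mem_bot] at hx'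
    simpa using hx'
  have hnorm : ∀ A ∈ 𝒯, ∀ n ∈ N, ∀ a ∈ A, n * a * n⁻¹ ∈ A := by
    rintro _ ⟨k, rfl⟩ n hn a ha
    simp only [mem_conj_iff] at ha ⊢
    have := hTn _ (hnN k⁻¹ n hn) _ ha
    group at this ⊢
    exact this
  have hminA : ∀ A ∈ 𝒯, ∀ B ≤ A, B ≠ ⊥ → (∀ n ∈ N, ∀ b ∈ B, n * b * n⁻¹ ∈ B) → B = A := by
    rintro _ ⟨k, rfl⟩ B hB hB1 hBn
    have hBT : MulAut.conj k⁻¹ • B = T := by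
      apply hTmin'
      · intro x hx
        rw [mem_conj_iff] at hx
        have := hB hx
        simp only [mem_conj_iff] at this
        group at this
        simpa using this
      · intro h
        refine hB1 ((Subgroup.eq_bot_iff_forall _).2 fun x hx => ?_)
        have hx' := conj_apply_mem k⁻¹ hx
        rw [h, Subgroup.mem_bot] at hx'
        exact conj_eq_one_iff.1 hx'
      · intro n hn b hb
        simp only [mem_conj_iff] at hb ⊢
        have := hBn _ (hnN k n hn) _ hb
        group at this ⊢
        exact this
    change B = MulAut.conj k • T
    rw [← hBT, ← mul_smul, ← map_mul, mul_inv_cancel, map_one, one_smul]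
  have hgen : ∀ X : Subgroup G, (∀ A ∈ 𝒯, A ≤ X) → N ≤ X := by
    intro X hX
    have hS : sSup 𝒯 = N := by
      apply hmin
      · refine ⟨fun n hn g => ?_⟩
        suffices h : sSup 𝒯 ≤ MulAut.conj g⁻¹ • sSup 𝒯 by
          have := h hn
          rw [mem_conj_iff] at this
          simpa using this
        refine sSup_le fun A hA x hx => ?_
        rw [mem_conj_iff]
        have := le_sSup (conj_mem A hA g) (conj_apply_mem g hx)
        simpa using this
      · intro h
        have : MulAut.conj (1 : G) • T ≤ sSup 𝒯 := le_sSup ⟨1, rfl⟩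
        rw [h, le_bot_iff] at this
        exact hbot _ ⟨1, rfl⟩ this
      · exact sSup_le hle
    rw [← hS]
    exact sSup_le hX
  have hcomm : ∀ A ∈ 𝒯, ∀ B ∈ 𝒯, A ≠ B → ∀ a ∈ A, ∀ b ∈ B, a * b = b * a := by
    intro A hA B hB hAB a ha b hb
    have hdis : A ⊓ B = ⊥ := by
      by_contra h
      have hn : ∀ n ∈ N, ∀ b ∈ A ⊓ B, n * b * n⁻¹ ∈ A ⊓ B := fun n hn b hb =>
        ⟨hnorm A hA n hn b hb.1, hnorm B hB n hn b hb.2⟩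
      exact hAB ((hminA A hA _ inf_le_left h hn).symm.trans (hminA B hB _ inf_le_right h hn))
    have h1 : a * b * a⁻¹ * b⁻¹ ∈ A ⊓ B := by
      refine Subgroup.mem_inf.2
        ⟨?_, mul_mem (hnorm B hB a (hle A hA ha) b hb) (inv_mem hb)⟩
      have := mul_mem ha (hnorm A hA b (hle B hB hb) a⁻¹ (inv_mem ha))
      group at this ⊢
      exact this
    rw [hdis, Subgroup.mem_bot, mul_inv_eq_one, mul_inv_eq_iff_eq_mul] at h1
    exact h1
  refine ⟨𝒯, ⟨_, 1, rfl⟩, conj_mem, hle, hbot, hnorm, hminA, ?_, hgen, hcomm, ?_⟩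
  · rintro _ ⟨k, rfl⟩ _ ⟨l, rfl⟩
    refine ⟨l * k⁻¹, ?_⟩
    change MulAut.conj _ • MulAut.conj k • T = MulAut.conj l • T
    rw [← mul_smul, ← map_mul, inv_mul_cancel_right]
  · intro A hA a ha hab
    apply hcent
    intro n hn
    have : N ≤ Subgroup.centralizer {a} := by
      apply hgen
      intro B hB b hb
      rw [Subgroup.mem_centralizer_singleton_iff]
      by_cases h : A = B
      · subst h
        exact (hab b hb).symm
      · exact (hcomm A hA B hB h a ha b hb).symm
    exact (Subgroup.mem_centralizer_singleton_iff.1 (this hn)).symm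

variable (hF : IsFactorFamily N 𝒯)
include hF

theorem decomp {A : Subgroup G} (hA : A ∈ 𝒯) {n : G} (hn : n ∈ N) :
    ∃ a ∈ A, ∃ c, (∀ b ∈ A, c * b = b * c) ∧ n = a * c := by
  let X : Subgroup G :=
    { carrier := {x | ∃ a ∈ A, ∃ c, (∀ b ∈ A, c * b = b * c) ∧ x = a * c}
      one_mem' := ⟨1, one_mem _, 1, fun b _ => by simp, by simp⟩
      mul_mem' := by
        rintro _ _ ⟨a, ha, c, hc, rfl⟩ ⟨b, hb, d, hd, rfl⟩
        refine ⟨a * b, mul_mem ha hb, c * d, fun e he => ?_, ?_⟩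
        · rw [mul_assoc, hd e he, ← mul_assoc, hc e he, mul_assoc]
        · rw [mul_assoc, ← mul_assoc c, hc b hb]
          group
      inv_mem' := by
        rintro _ ⟨a, ha, c, hc, rfl⟩
        refine ⟨a⁻¹, inv_mem ha, c⁻¹, fun e he => ?_, ?_⟩
        · rw [inv_mul_eq_iff_eq_mul, ← mul_assoc, hc e he, mul_inv_cancel_right]
        · rw [← mul_inv_rev, hc a ha] }
  refine hF.generate X (fun B hB x hx => ?_) hn
  by_cases h : A = B
  · subst h
    exact ⟨x, hx, 1, fun b _ => by simp, by simp⟩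
  · exact ⟨1, one_mem _, x, fun b hb => (hF.commute A hA B hB h b hb x hx).symm, by simp⟩

theorem decomp_unique {A : Subgroup G} (hA : A ∈ 𝒯) {a b c d : G} (ha : a ∈ A) (hb : b ∈ A)
    (hc : ∀ x ∈ A, c * x = x * c) (hd : ∀ x ∈ A, d * x = x * d) (h : a * c = b * d) :
    a = b ∧ c = d := by
  have h1 : b⁻¹ * a = d * c⁻¹ := by
    rw [inv_mul_eq_iff_eq_mul, ← mul_assoc, ← h, mul_inv_cancel_right]
  have h2 : b⁻¹ * a = 1 := by
    refine hF.disjoint A hA _ (mul_mem (inv_mem hb) ha) fun x hx => ?_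
    have : c⁻¹ * x = x * c⁻¹ := by
      rw [inv_mul_eq_iff_eq_mul, ← mul_assoc, hc x hx, mul_inv_cancel_right]
    rw [h1, mul_assoc, this, ← mul_assoc, hd x hx, mul_assoc]
  have hab : a = b := (inv_mul_eq_one.1 h2).symm
  exact ⟨hab, by rw [hab] at h; exact mul_left_cancel h⟩

/-- The orders of the nontrivial elements of a factor are not all equal. -/
theorem exists_orderOf_ne [Finite G] {A : Subgroup G} (hA : A ∈ 𝒯) (q : ℕ) :
    ∃ z ∈ A, z ≠ 1 ∧ orderOf z ≠ q := by
  by_contra! hq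
  obtain ⟨a, ha, ha1⟩ := (A.bot_or_exists_ne_one).resolve_left (hF.ne_bot A hA)
  have hqa := hq a ha ha1
  have hq1 : q ≠ 1 := fun h => ha1 (orderOf_eq_one_iff.1 (hqa.trans h))
  have hqp : q.Prime := by
    have hp := Nat.minFac_prime hq1
    obtain ⟨m, hm⟩ := Nat.minFac_dvd q
    have hq0 : 0 < q := hqa ▸ orderOf_pos a
    have hm0 : m ≠ 0 := by rintro rfl; omega
    have ho : orderOf (a ^ m) = q.minFac := by
      rw [orderOf_pow_of_dvd hm0 (by rw [hqa]; exact ⟨_, by rw [mul_comm]; exact hm⟩), hqa]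
      exact Nat.div_eq_of_eq_mul_left (Nat.pos_of_ne_zero hm0) hm
    have := hq (a ^ m) (pow_mem ha m) fun h => by
      rw [h, orderOf_one] at ho
      exact hp.one_lt.ne ho
    rw [← this, ho]
    exact hp
  have : Fact q.Prime := ⟨hqp⟩
  have hpg : IsPGroup q A := fun g => ⟨1, by
    by_cases h : g = 1
    · simp [h]
    · rw [pow_one, ← hq g g.2 fun h' => h (Subtype.ext h'), Subgroup.orderOf_coe,
        pow_orderOf_eq_one]⟩
  have : Nontrivial A := ⟨⟨a, ha⟩, 1, fun h => ha1 (congrArg Subtype.val h)⟩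
  have := hpg.center_nontrivial
  obtain ⟨z, hz⟩ := exists_ne (1 : Subgroup.center A)
  refine hz (Subtype.ext (Subtype.ext (hF.disjoint A hA _ z.1.2 fun b hb => ?_)))
  exact congrArg Subtype.val (Subgroup.mem_center_iff.1 z.2 ⟨b, hb⟩).symm

end IsFactorFamily

namespace IsFactorFamily

variable {G : Type*} [Group G] {N : Subgroup G} {𝒯 : Set (Subgroup G)} (hF : IsFactorFamily N 𝒯)
include hF

theorem exists_ne (hN : N ∉ 𝒯) {A : Subgroup G} (hA : A ∈ 𝒯) : ∃ B ∈ 𝒯, B ≠ A := by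
  by_contra! h
  refine hN ?_
  rwa [le_antisymm (hF.generate A fun B hB => (h B hB).le) (hF.le A hA)]

theorem conj_eq {A : Subgroup G} (hA : A ∈ 𝒯) {n : G} (hn : n ∈ N) : MulAut.conj n • A = A := by
  ext x
  rw [mem_conj_iff]
  constructor
  · intro hx
    have := hF.normalized A hA n hn _ hx
    group at this
    exact this
  · intro hx
    have := hF.normalized A hA _ (inv_mem hn) _ hx
    rwa [inv_inv] at this

theorem exists_stabilizer_conj_eq {Ω : Type*} [MulAction G Ω] {α : Ω}
    (htr : ∀ β : Ω, ∃ n ∈ N, n • α = β) {A B : Subgroup G} (hA : A ∈ 𝒯) (hB : B ∈ 𝒯) :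
    ∃ h ∈ MulAction.stabilizer G α, MulAut.conj h • A = B := by
  obtain ⟨g, hg⟩ := hF.conj_trans A hA B hB
  obtain ⟨n, hn, hnα⟩ := htr (g • α)
  refine ⟨n⁻¹ * g, ?_, ?_⟩
  · rw [MulAction.mem_stabilizer_iff, mul_smul, ← hnα, inv_smul_smul]
  · rw [map_mul, mul_smul, hg, hF.conj_eq hB (inv_mem hn)]

/-- A subgroup of a factor `A` normalized by `A` is normalized by `N`. -/
theorem normalized_of_normalized {A B : Subgroup G} (hA : A ∈ 𝒯) (hBA : B ≤ A)
    (h : ∀ a ∈ A, ∀ b ∈ B, a * b * a⁻¹ ∈ B) : ∀ n ∈ N, ∀ b ∈ B, n * b * n⁻¹ ∈ B := by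
  intro n hn b hb
  obtain ⟨a, ha, c, hc, rfl⟩ := hF.decomp hA hn
  have : a * c * b * (a * c)⁻¹ = a * b * a⁻¹ := by
    rw [mul_assoc a, hc b (hBA hb)]
    group
  rw [this]
  exact h a ha b hb

theorem eq_one_of_commute_factors (hcent : ∀ x : G, (∀ n ∈ N, x * n = n * x) → x = 1) {x : G}
    (hx : ∀ A ∈ 𝒯, ∀ a ∈ A, x * a = a * x) : x = 1 := by
  refine hcent x fun n hn => ?_
  have : N ≤ Subgroup.centralizer {x} := hF.generate _ fun A hA a ha =>
    Subgroup.mem_centralizer_singleton_iff.2 (hx A hA a ha).symm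
  exact (Subgroup.mem_centralizer_singleton_iff.1 (this hn)).symm

variable {K : Subgroup G}
  (hproj : ∀ A ∈ 𝒯, ∀ a ∈ A, ∀ c, (∀ b ∈ A, c * b = b * c) → a * c ∈ K → a ∈ K)
include hproj

theorem conj_eq_of_fixes {A : Subgroup G} (hA : A ∈ 𝒯) {t h : G} (ht : t ∈ A) (htK : t ∉ K)
    (hfix : t⁻¹ * (h * t * h⁻¹) ∈ K) : MulAut.conj h • A = A := by
  by_contra hne
  refine htK (inv_mem_iff.1 (hproj A hA t⁻¹ (inv_mem ht) (h * t * h⁻¹) (fun b hb => ?_) hfix))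
  exact hF.commute _ (hF.conj_mem A hA h) A hA hne _ (conj_apply_mem h ht) b hb

/-- An element fixing the coset of `t * z`, where `t` and `z` lie in distinct factors, either
fixes the cosets of `t` and `z`, or moves the factor of `z` to that of `t`. -/
theorem fixes_or_swaps {A B : Subgroup G} (hA : A ∈ 𝒯) (hB : B ∈ 𝒯) (hAB : A ≠ B) {t z h : G}
    (ht : t ∈ A) (htK : t ∉ K) (hz : z ∈ B) (hfix : (t * z)⁻¹ * (h * (t * z) * h⁻¹) ∈ K) :
    (MulAut.conj h • A = A ∧ t⁻¹ * (h * t * h⁻¹) ∈ K ∧ z⁻¹ * (h * z * h⁻¹) ∈ K) ∨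
      (MulAut.conj h • B = A ∧ t⁻¹ * (h * z * h⁻¹) ∈ K) := by
  have ht' := conj_apply_mem h ht
  have hz' := conj_apply_mem h hz
  have hzA : ∀ b ∈ A, z * b = b * z := fun b hb => (hF.commute A hA B hB hAB b hb z hz).symm
  have hziA : ∀ b ∈ A, z⁻¹ * b = b * z⁻¹ := fun b hb =>
    (hF.commute A hA B hB hAB b hb z⁻¹ (inv_mem hz)).symm
  have hcomm : ∀ C ∈ 𝒯, C ≠ A → ∀ x ∈ C, ∀ b ∈ A, x * b = b * x := fun C hC hCA x hx b hb =>
    hF.commute C hC A hA hCA x hx b hb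
  have hA' := hF.conj_mem A hA h
  have hB' := hF.conj_mem B hB h
  have hne : MulAut.conj h • A ≠ MulAut.conj h • B := fun h' => hAB (smul_left_cancel _ h')
  have hexp : h * (t * z) * h⁻¹ = (h * t * h⁻¹) * (h * z * h⁻¹) := by group
  rw [hexp] at hfix
  by_cases h1 : MulAut.conj h • A = A
  · left
    rw [h1] at ht'
    have hz'A := hcomm _ hB' (fun h2 => hne (h1.trans h2.symm)) _ hz'
    have hsplit : (t * z)⁻¹ * ((h * t * h⁻¹) * (h * z * h⁻¹)) =
        (t⁻¹ * (h * t * h⁻¹)) * (z⁻¹ * (h * z * h⁻¹)) := by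
      have := hziA _ (mul_mem (inv_mem ht) ht')
      rw [mul_inv_rev, mul_assoc, ← mul_assoc t⁻¹, ← mul_assoc z⁻¹, this, mul_assoc]
    rw [hsplit] at hfix
    have hK := hproj A hA _ (mul_mem (inv_mem ht) ht') _ (fun b hb => by
      rw [mul_assoc, hz'A b hb, ← mul_assoc, hziA b hb, mul_assoc]) hfix
    exact ⟨h1, hK, (mul_mem_cancel_left hK).1 hfix⟩
  · have ht'A := hcomm _ hA' h1 _ ht'
    by_cases h2 : MulAut.conj h • B = A
    · right
      rw [h2] at hz'
      have hsplit : (t * z)⁻¹ * ((h * t * h⁻¹) * (h * z * h⁻¹)) =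
          (t⁻¹ * (h * z * h⁻¹)) * (z⁻¹ * (h * t * h⁻¹)) := by
        have := hziA _ (mul_mem (inv_mem ht) hz')
        rw [ht'A _ hz', mul_inv_rev, mul_assoc, ← mul_assoc t⁻¹, ← mul_assoc z⁻¹, this, mul_assoc]
      rw [hsplit] at hfix
      exact ⟨h2, hproj A hA _ (mul_mem (inv_mem ht) hz') _ (fun b hb => by
        rw [mul_assoc, ht'A b hb, ← mul_assoc, hziA b hb, mul_assoc]) hfix⟩
    · exfalso
      have hz'A := hcomm _ hB' h2 _ hz'
      have hsplit : (t * z)⁻¹ * ((h * t * h⁻¹) * (h * z * h⁻¹)) =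
          t⁻¹ * (z⁻¹ * ((h * t * h⁻¹) * (h * z * h⁻¹))) := by
        rw [← mul_assoc t⁻¹, ← hziA _ (inv_mem ht), ← mul_inv_rev]
      rw [hsplit] at hfix
      refine htK (inv_mem_iff.1 (hproj A hA _ (inv_mem ht) _ (fun b hb => ?_) hfix))
      rw [mul_assoc, mul_assoc, hz'A b hb, ← mul_assoc (h * t * h⁻¹), ht'A b hb, ← mul_assoc z⁻¹,
        ← mul_assoc z⁻¹, hziA b hb]
      simp only [mul_assoc]

end IsFactorFamily

/-! ### Subdegrees of primitive groups with a nonabelian socle -/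

theorem Subgroup.card_inf_mul_relIndex {G : Type*} [Group G] (Z H : Subgroup G) :
    Nat.card (Z ⊓ H : Subgroup G) * Z.relIndex H = Nat.card H := by
  rw [← Subgroup.inf_relIndex_right, Subgroup.relIndex,
    ← Nat.card_congr (Subgroup.subgroupOfEquivOfLe (inf_le_right : Z ⊓ H ≤ H)).toEquiv,
    Subgroup.card_mul_index]

theorem Subgroup.inf_le_of_relIndex_eq {G : Type*} [Group G] [Finite G] {Z₁ Z₂ H : Subgroup G}
    (h : Z₁.relIndex H = Z₂.relIndex H) (hle : Z₁ ⊓ H ≤ Z₂) : Z₂ ⊓ H ≤ Z₁ := by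
  have h1 := Subgroup.card_inf_mul_relIndex Z₁ H
  have h2 := Subgroup.card_inf_mul_relIndex Z₂ H
  rw [← h] at h2
  have hpos : 0 < Z₁.relIndex H := Nat.pos_of_ne_zero Subgroup.index_ne_zero_of_finite
  have hcard := Nat.eq_of_mul_eq_mul_right hpos (h2.trans h1.symm)
  have : Z₁ ⊓ H = Z₂ ⊓ H := Subgroup.eq_of_le_of_card_ge (le_inf hle inf_le_right) hcard.le
  rw [← this]
  exact inf_le_left

theorem smul_smul_eq_iff_of_mem_stabilizer {G Ω : Type*} [Group G] [MulAction G Ω] {α : Ω}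
    {N : Subgroup G} [N.Normal] {h x : G} (hh : h ∈ MulAction.stabilizer G α) (hx : x ∈ N) :
    h • x • α = x • α ↔ x⁻¹ * (h * x * h⁻¹) ∈ N ⊓ MulAction.stabilizer G α := by
  have hN : x⁻¹ * (h * x * h⁻¹) ∈ N :=
    mul_mem (inv_mem hx) (Subgroup.Normal.conj_mem ‹_› x hx h)
  have hinv : h⁻¹ • α = α := inv_mem hh
  rw [Subgroup.mem_inf, and_iff_right hN, MulAction.mem_stabilizer_iff, mul_smul, mul_smul, hinv,
    inv_smul_eq_iff, mul_smul]

/-- If the product of any two elements of `V` outside `D` lies in `D`, then `D` has index at most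
two in `V`, hence contains the squares of every group of the same order containing it. -/
theorem Subgroup.sq_mem_of_card_eq {G : Type*} [Group G] [Finite G] {D U V : Subgroup G}
    (hDU : D ≤ U) (hDV : D ≤ V) (hcard : Nat.card U = Nat.card V)
    (h : ∀ a ∈ V, a ∉ D → ∀ b ∈ V, b ∉ D → b * a ∈ D) {l : G} (hl : l ∈ U) : l ^ 2 ∈ D := by
  by_cases hVD : V ≤ D
  · have : D = U := Subgroup.eq_of_le_of_card_ge hDU (hcard.trans_le (Subgroup.card_le_of_le hVD))
    rw [this]
    exact pow_mem hl 2
  · obtain ⟨a, haV, haD⟩ := Set.not_subset.1 hVD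
    have h2 : (D.subgroupOf V).index = 2 := by
      rw [Subgroup.index_eq_two_iff_exists_notMem_and]
      refine ⟨⟨a, haV⟩, haD, fun b => ?_⟩
      by_cases hb : (b : G) ∈ D
      · exact Or.inr hb
      · exact Or.inl (h a haV haD b b.2 hb)
    have hV := Subgroup.card_inf_mul_relIndex D V
    have hU := Subgroup.card_inf_mul_relIndex D U
    rw [inf_eq_left.2 hDV] at hV
    rw [inf_eq_left.2 hDU, hcard, ← hV] at hU
    have hU2 : (D.subgroupOf U).index = 2 :=
      (Nat.eq_of_mul_eq_mul_left Nat.card_pos hU).trans h2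
    exact Subgroup.sq_mem_of_index_two hU2 ⟨l, hl⟩

section Primitive

variable {G Ω : Type*} [Group G] [MulAction G Ω] {α : Ω} {s : ℕ} {N : Subgroup G}

/-- A `p`-subgroup of a transitive group of degree coprime to `p` is conjugate to a subgroup of
the point stabilizer. -/
theorem exists_conj_mem_stabilizer {p : ℕ} [Fact p.Prime] (hp : ¬ p ∣ Nat.card Ω)
    (htr : ∀ β : Ω, ∃ n ∈ N, n • α = β) {P : Subgroup G} (hP : IsPGroup p P) :
    ∃ n ∈ N, ∀ x ∈ P, n⁻¹ * x * n ∈ MulAction.stabilizer G α := by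
  obtain ⟨β, hβ⟩ := hP.nonempty_fixed_point_of_prime_not_dvd_card Ω hp
  obtain ⟨n, hn, rfl⟩ := htr β
  refine ⟨n, hn, fun x hx => ?_⟩
  have : x • n • α = n • α := hβ ⟨x, hx⟩
  rw [MulAction.mem_stabilizer_iff, mul_smul, mul_smul, this, inv_smul_smul]

variable [Finite G] [N.Normal] {𝒯 : Set (Subgroup G)} (hF : IsFactorFamily N 𝒯) (hNT : N ∉ 𝒯)
  (hcent : ∀ x : G, (∀ n ∈ N, x * n = n * x) → x = 1)
  (hmin : ∀ M : Subgroup G, M.Normal → M ≠ ⊥ → M ≤ N → M = N)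
  (hmax : ∀ X : Subgroup G, MulAction.stabilizer G α ≤ X → X = MulAction.stabilizer G α ∨ X = ⊤)

include hF hNT hcent in
/-- If `N` is regular, then every element of the point stabilizer acts on `N` without fixed
points. -/
theorem eq_one_of_commute_of_regular
    (hreg : N ⊓ MulAction.stabilizer G α = ⊥)
    (hs : ∀ β, β ≠ α → (MulAction.stabilizer G β).relIndex (MulAction.stabilizer G α) = s)
    {x h : G} (hx : x ∈ N) (hx1 : x ≠ 1) (hh : h ∈ MulAction.stabilizer G α)
    (hhx : h * x = x * h) : h = 1 := by
  have hfix : ∀ x ∈ N, ∀ h ∈ MulAction.stabilizer G α,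
      (h ∈ MulAction.stabilizer G (x • α) ↔ h * x = x * h) := by
    intro x hx h hh
    rw [MulAction.mem_stabilizer_iff, smul_smul_eq_iff_of_mem_stabilizer hh hx, hreg,
      Subgroup.mem_bot, inv_mul_eq_one, eq_mul_inv_iff_mul_eq, eq_comm]
  have hne : ∀ x ∈ N, x ≠ 1 → x • α ≠ α := fun x hx hx1 h => hx1 (by
    have : x ∈ N ⊓ MulAction.stabilizer G α := ⟨hx, h⟩
    rwa [hreg] at this)
  have hproj : ∀ A ∈ 𝒯, ∀ a ∈ A, ∀ c, (∀ b ∈ A, c * b = b * c) → a * c ∈ (⊥ : Subgroup G) →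
      a ∈ (⊥ : Subgroup G) := by
    intro A hA a ha c hc h
    rw [Subgroup.mem_bot] at h ⊢
    exact (hF.decomp_unique hA ha (one_mem A) hc (d := 1) (by simp) (by rw [h, one_mul])).1
  have htransfer : ∀ x ∈ N, ∀ y ∈ N, x ≠ 1 → y ≠ 1 →
      (∀ h ∈ MulAction.stabilizer G α, h * x = x * h → h * y = y * h) →
      ∀ h ∈ MulAction.stabilizer G α, h * y = y * h → h * x = x * h := by
    intro x hx y hy hx1 hy1 hxy h hh hhy
    refine (hfix x hx h hh).1 (Subgroup.inf_le_of_relIndex_eq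
      ((hs _ (hne x hx hx1)).trans (hs _ (hne y hy hy1)).symm) ?_
      ⟨(hfix y hy h hh).2 hhy, hh⟩)
    intro k hk
    exact (hfix y hy k hk.2).2 (hxy k hk.2 ((hfix x hx k hk.2).1 hk.1))
  have hpair : ∀ A ∈ 𝒯, ∀ B ∈ 𝒯, A ≠ B → ∀ t ∈ A, ∀ z ∈ B, t ≠ 1 → z ≠ 1 →
      orderOf t ≠ orderOf z → ∀ h ∈ MulAction.stabilizer G α, h * t = t * h → h * z = z * h := by
    intro A hA B hB hAB t ht z hz ht1 hz1 hord
    have hboth : ∀ h ∈ MulAction.stabilizer G α, h * (t * z) = t * z * h →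
        h * t = t * h ∧ h * z = z * h := by
      intro h _ hcomm
      have := hF.fixes_or_swaps (K := ⊥) hproj hA hB hAB (h := h) ht
        (by rwa [Subgroup.mem_bot]) hz (by rw [Subgroup.mem_bot, hcomm]; group)
      simp only [Subgroup.mem_bot, inv_mul_eq_one, eq_mul_inv_iff_mul_eq] at this
      rcases this with ⟨-, h1, h2⟩ | ⟨-, h1⟩
      · exact ⟨h1.symm, h2.symm⟩
      · refine absurd ?_ hord
        rw [eq_mul_inv_of_mul_eq h1, ← MulAut.conj_apply]
        exact MulEquiv.orderOf_eq (MulAut.conj h) z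
    have htz1 : t * z ≠ 1 := by
      intro h
      apply hord
      rw [eq_inv_of_mul_eq_one_left h, orderOf_inv]
    have htN := hF.le A hA ht
    have hzN := hF.le B hB hz
    intro h hh hht
    exact (hboth h hh (htransfer (t * z) (mul_mem htN hzN) t htN htz1 ht1
      (fun k hk hk' => (hboth k hk hk').1) h hh hht)).2
  have hothers : ∀ A ∈ 𝒯, ∀ B ∈ 𝒯, A ≠ B → ∀ t ∈ A, t ≠ 1 →
      ∀ h ∈ MulAction.stabilizer G α, h * t = t * h → ∀ b ∈ B, h * b = b * h := by
    intro A hA B hB hAB t ht ht1 h hh hht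
    let S : Set G := {z | z ∈ B ∧ orderOf z ≠ orderOf t}
    have hcl : Subgroup.closure S = B := by
      refine hF.minimal B hB _ ((Subgroup.closure_le B).2 fun z hz => hz.1) ?_ ?_
      · intro hbot
        obtain ⟨z, hzB, hz1, hz⟩ := hF.exists_orderOf_ne hB (orderOf t)
        have : z ∈ Subgroup.closure S := Subgroup.subset_closure ⟨hzB, hz⟩
        rw [hbot, Subgroup.mem_bot] at this
        exact hz1 this
      · intro n hn b hb
        suffices hle : Subgroup.closure S ≤
            (Subgroup.closure S).comap (MulAut.conj n).toMonoidHom from hle hb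
        rw [Subgroup.closure_le]
        intro z hz
        refine Subgroup.subset_closure ⟨hF.normalized B hB n hn z hz.1, ?_⟩
        have : orderOf (MulAut.conj n z) = orderOf z := MulEquiv.orderOf_eq (MulAut.conj n) z
        exact this.trans_ne hz.2
    have hle : Subgroup.closure S ≤ Subgroup.centralizer {h} := by
      rw [Subgroup.closure_le]
      intro z hz
      refine Subgroup.mem_centralizer_singleton_iff.2 ?_
      by_cases hz1 : z = 1
      · simp [hz1]
      · exact (hpair A hA B hB hAB t ht z hz.1 ht1 hz1 hz.2.symm h hh hht).symm
    rw [hcl] at hle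
    exact fun b hb => (Subgroup.mem_centralizer_singleton_iff.1 (hle hb)).symm
  have hfactor : ∀ A ∈ 𝒯, ∀ t ∈ A, t ≠ 1 →
      ∀ h ∈ MulAction.stabilizer G α, h * t = t * h → h = 1 := by
    intro A hA t ht ht1 h hh hht
    obtain ⟨B, hB, hBA⟩ := hF.exists_ne hNT hA
    obtain ⟨z, hz, hz1⟩ := B.bot_or_exists_ne_one.resolve_left (hF.ne_bot B hB)
    have hhz := hothers A hA B hB hBA.symm t ht ht1 h hh hht z hz
    refine hF.eq_one_of_commute_factors hcent fun C hC => ?_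
    by_cases hCA : A = C
    · exact hothers B hB C hC (hCA ▸ hBA) z hz hz1 h hh hhz
    · exact hothers A hA C hC hCA t ht ht1 h hh hht
  obtain ⟨A, hA⟩ := hF.nonempty
  obtain ⟨t, ht, ht1⟩ := A.bot_or_exists_ne_one.resolve_left (hF.ne_bot A hA)
  refine hfactor A hA t ht ht1 h hh (htransfer t (hF.le A hA ht) x hx ht1 hx1 ?_ h hh hhx)
  intro k hk hkt
  rw [hfactor A hA t ht ht1 k hk hkt, one_mul, mul_one]

include hcent hmin hmax in
/-- The point stabilizer does not act fixed-point-freely on a regular minimal normal subgroup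
with trivial centralizer. -/
theorem false_of_fixedPointFree (hN : N ≠ ⊥) (hreg : N ⊓ MulAction.stabilizer G α = ⊥)
    (hfree : ∀ x ∈ N, x ≠ 1 → ∀ h ∈ MulAction.stabilizer G α, h * x = x * h → h = 1) : False := by
  have hcard : Nat.card N ≠ 1 := fun h => hN (Subgroup.card_eq_one.1 h)
  obtain ⟨p, hp, hpN⟩ := Nat.exists_prime_and_dvd hcard
  have : Fact p.Prime := ⟨hp⟩
  let φ : MulAction.stabilizer G α →* MulAut N :=
    MulAut.conjNormal.comp (MulAction.stabilizer G α).subtype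
  let act : MulDistribMulAction (MulAction.stabilizer G α) N := MulDistribMulAction.compHom N φ
  have hact : ∀ (h : MulAction.stabilizer G α) (x : N), ((h • x : N) : G) = h * x * (h : G)⁻¹ :=
    fun h x => rfl
  obtain ⟨P, hP⟩ := exists_sylow_fixed_of_fixedPointFree
    (Q := MulAction.stabilizer G α) (N := N) (fun q hq x hqx => by
      by_contra hx
      refine hq (Subtype.ext (hfree x x.2 (fun h => hx (Subtype.ext h)) q q.2 ?_))
      have := congrArg Subtype.val hqx
      rwa [hact, mul_inv_eq_iff_eq_mul] at this) p
  let P' : Subgroup G := (P : Subgroup N).map N.subtype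
  have hP'N : P' ≤ N := Subgroup.map_subtype_le _
  have hP'1 : P' ≠ ⊥ := by
    intro h
    rw [Subgroup.map_eq_bot_iff_of_injective _ N.subtype_injective] at h
    exact P.ne_bot_of_dvd_card hpN h
  have hnorm : MulAction.stabilizer G α ≤ Subgroup.normalizer (P' : Set G) := by
    intro h hh
    apply Subgroup.mem_normalizer_fintype
    rintro _ ⟨x, hx, rfl⟩
    have hx' : (⟨h, hh⟩ : MulAction.stabilizer G α) • x ∈
        (⟨h, hh⟩ : MulAction.stabilizer G α) • (P : Subgroup N) :=
      Subgroup.smul_mem_pointwise_smul x _ _ hx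
    rw [← Sylow.pointwise_smul_def, hP] at hx'
    exact ⟨_, hx', rfl⟩
  rcases hmax _ hnorm with h | h
  · apply hP'1
    rw [eq_bot_iff, ← hreg, ← h]
    exact le_inf hP'N Subgroup.le_normalizer
  · rw [Subgroup.normalizer_eq_top_iff] at h
    have hPN := hmin P' h hP'1 hP'N
    have hpN : IsPGroup p N := by
      rw [← hPN]
      exact P.isPGroup'.map _
    have : Nontrivial N := (Subgroup.nontrivial_iff_ne_bot N).2 hN
    have := hpN.center_nontrivial
    obtain ⟨z, hz⟩ := exists_ne (1 : Subgroup.center N)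
    refine hz (Subtype.ext (Subtype.ext (hcent _ fun n hn => ?_)))
    exact congrArg Subtype.val (Subgroup.mem_center_iff.1 z.2 ⟨n, hn⟩).symm

end Primitive

section Primitive

variable {G Ω : Type*} [Group G] [Finite G] [MulAction G Ω] {α : Ω} {s : ℕ} {N : Subgroup G}
  [N.Normal]

theorem coprime_relIndex_of_normalizes [Finite Ω] {K : Subgroup G}
    (hs : ∀ β, β ≠ α → (MulAction.stabilizer G β).relIndex (MulAction.stabilizer G α) = s)
    (hKH : K ≤ MulAction.stabilizer G α)
    (hK : ∀ h ∈ MulAction.stabilizer G α, ∀ k ∈ K, h * k * h⁻¹ ∈ K) {β : Ω} (hβ : β ≠ α) :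
    ((MulAction.stabilizer G β).relIndex K).Coprime (Nat.card Ω) := by
  have hdvd := Subgroup.relIndex_dvd_relIndex_of_normalizes (MulAction.stabilizer G β) hKH hK
  rw [hs β hβ] at hdvd
  exact Nat.Coprime.of_dvd_left hdvd (coprime_card_of_orbits_eq (H := MulAction.stabilizer G α)
    (fun h => h.2) fun β hβ => (card_orbit_eq_relIndex _ β).trans (hs β hβ))

variable {𝒯 : Set (Subgroup G)} (hF : IsFactorFamily N 𝒯) (hNT : N ∉ 𝒯)
  (hcent : ∀ x : G, (∀ n ∈ N, x * n = n * x) → x = 1)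
  (hmin : ∀ M : Subgroup G, M.Normal → M ≠ ⊥ → M ≤ N → M = N)
  (hmax : ∀ X : Subgroup G, MulAction.stabilizer G α ≤ X → X = MulAction.stabilizer G α ∨ X = ⊤)
  (htr : ∀ β : Ω, ∃ n ∈ N, n • α = β)
  (hs : ∀ β, β ≠ α → (MulAction.stabilizer G β).relIndex (MulAction.stabilizer G α) = s)

omit [Finite G] in
theorem conj_mem_inf_stabilizer {h k : G} (hh : h ∈ MulAction.stabilizer G α)
    (hk : k ∈ N ⊓ MulAction.stabilizer G α) : h * k * h⁻¹ ∈ N ⊓ MulAction.stabilizer G α :=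
  Subgroup.mem_inf.2 ⟨Subgroup.Normal.conj_mem ‹_› k hk.1 h, mul_mem (mul_mem hh hk.2) (inv_mem hh)⟩

include hF hcent htr hs in
/-- If `N` is not regular, then some factor meets the point stabilizer in an element of prime
order not dividing the degree. -/
theorem exists_prime_order_mem_stabilizer [Finite Ω] [FaithfulSMul G Ω]
    (hreg : N ⊓ MulAction.stabilizer G α ≠ ⊥) :
    ∃ p : ℕ, p.Prime ∧ ¬ p ∣ Nat.card Ω ∧ ∃ A ∈ 𝒯, ∃ a ∈ A, a ≠ 1 ∧ a ^ p = 1 ∧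
      a ∈ MulAction.stabilizer G α := by
  obtain ⟨k, hk, hk1⟩ := (Subgroup.bot_or_exists_ne_one _).resolve_left hreg
  obtain ⟨β, hβ⟩ : ∃ β : Ω, k • β ≠ β := by
    by_contra! h
    exact hk1 (FaithfulSMul.eq_of_smul_eq_smul (α := Ω) fun β => by rw [h, one_smul])
  have hβα : β ≠ α := by
    rintro rfl
    exact hβ hk.2
  have hcop := coprime_relIndex_of_normalizes hs inf_le_right
    (fun h hh k hk => conj_mem_inf_stabilizer (N := N) hh hk) hβα
  have hr : (MulAction.stabilizer G β).relIndex (N ⊓ MulAction.stabilizer G α) ≠ 1 := fun h =>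
    hβ (Subgroup.relIndex_eq_one.1 h hk)
  obtain ⟨p, hp, hpr⟩ := Nat.exists_prime_and_dvd hr
  have : Fact p.Prime := ⟨hp⟩
  have hpn : ¬ p ∣ Nat.card Ω := fun h =>
    hp.one_lt.ne' (Nat.eq_one_of_dvd_coprimes hcop hpr h)
  refine ⟨p, hp, hpn, ?_⟩
  obtain ⟨x, hx⟩ := exists_prime_orderOf_dvd_card' p
    (hpr.trans (Subgroup.relIndex_dvd_card _ (N ⊓ MulAction.stabilizer G α)))
  have hxp : (x : G) ^ p = 1 := by
    rw [← hx, ← Subgroup.orderOf_coe, pow_orderOf_eq_one]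
  have hx1 : (x : G) ≠ 1 := by
    intro h
    rw [← Subgroup.orderOf_coe, h, orderOf_one] at hx
    exact hp.one_lt.ne hx
  obtain ⟨A, hA, a, ha, ha1, hap⟩ : ∃ A ∈ 𝒯, ∃ a ∈ A, a ≠ 1 ∧ a ^ p = 1 := by
    by_contra! hno
    refine hx1 (hF.eq_one_of_commute_factors hcent fun A hA => ?_)
    obtain ⟨a, ha, c, hc, hac⟩ := hF.decomp hA x.2.1
    have hap : a ^ p = 1 := by
      rw [hac, (show Commute a c from (hc a ha).symm).mul_pow] at hxp
      exact (hF.decomp_unique hA (pow_mem ha p) (one_mem A) (d := 1) (fun b hb => by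
        exact ((show Commute c b from hc b hb).pow_left p)) (by simp) (by rw [hxp, one_mul])).1
    have ha1 : a = 1 := by
      by_contra h
      exact hno A hA a ha h hap
    rw [hac, ha1, one_mul]
    exact hc
  have hP : IsPGroup p (Subgroup.zpowers a) := by
    have := IsPGroup.of_card (p := p) (G := Subgroup.zpowers a) (n := 1) (by
      rw [Nat.card_zpowers, pow_one]
      exact orderOf_eq_prime hap ha1)
    exact this
  obtain ⟨n, hn, hconj⟩ := exists_conj_mem_stabilizer (α := α) hpn htr hP
  refine ⟨A, hA, n⁻¹ * a * n, ?_, ?_, ?_, hconj a (Subgroup.mem_zpowers a)⟩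
  · simpa using hF.normalized A hA n⁻¹ (inv_mem hn) a ha
  · intro h
    refine ha1 ?_
    have : a = n * (n⁻¹ * a * n) * n⁻¹ := by group
    rw [this, h]
    group
  · have := conj_pow (i := p) (a := n⁻¹) (b := a)
    rw [inv_inv] at this
    rw [this, hap]
    group

omit [N.Normal] in
include hF hmin hmax in
/-- If `N` is not regular, then the point stabilizer in each factor is self-normalizing. -/
theorem mem_stabilizer_of_normalizes (hNα : ¬ N ≤ MulAction.stabilizer G α)
    (hA1 : ∃ A ∈ 𝒯, A ⊓ MulAction.stabilizer G α ≠ ⊥) {A : Subgroup G} (hA : A ∈ 𝒯) {a : G}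
    (ha : a ∈ A) (haA : ∀ x ∈ A ⊓ MulAction.stabilizer G α,
      a * x * a⁻¹ ∈ A ⊓ MulAction.stabilizer G α) : a ∈ MulAction.stabilizer G α := by
  let S : Set G := {x | ∃ B ∈ 𝒯, x ∈ B ⊓ MulAction.stabilizer G α}
  have hclN : Subgroup.closure S ≤ N := by
    rw [Subgroup.closure_le]
    rintro x ⟨B, hB, hx⟩
    exact hF.le B hB hx.1
  have hclH : Subgroup.closure S ≤ MulAction.stabilizer G α := by
    rw [Subgroup.closure_le]
    rintro x ⟨B, hB, hx⟩
    exact hx.2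
  have hnorm : ∀ g : G, (∀ x ∈ S, g * x * g⁻¹ ∈ S) →
      g ∈ Subgroup.normalizer (Subgroup.closure S : Set G) := by
    intro g hg
    apply Subgroup.mem_normalizer_fintype
    suffices hle : Subgroup.closure S ≤
        (Subgroup.closure S).comap (MulAut.conj g).toMonoidHom from fun x hx => hle hx
    rw [Subgroup.closure_le]
    exact fun x hx => Subgroup.subset_closure (hg x hx)
  have hH : MulAction.stabilizer G α ≤ Subgroup.normalizer (Subgroup.closure S : Set G) := by
    refine fun h hh => hnorm h ?_
    rintro x ⟨B, hB, hx⟩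
    exact ⟨_, hF.conj_mem B hB h, Subgroup.mem_inf.2
      ⟨IsFactorFamily.conj_apply_mem h hx.1, mul_mem (mul_mem hh hx.2) (inv_mem hh)⟩⟩
  rcases hmax _ hH with h | h
  · rw [← h]
    refine hnorm a ?_
    rintro x ⟨B, hB, hx⟩
    by_cases hAB : A = B
    · subst hAB
      exact ⟨A, hA, haA x hx⟩
    · rw [hF.commute A hA B hB hAB a ha x hx.1, mul_inv_cancel_right]
      exact ⟨B, hB, hx⟩
  · rw [Subgroup.normalizer_eq_top_iff] at h
    refine absurd ?_ hNα
    rw [← hmin _ h ?_ hclN]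
    · exact hclH
    · intro hbot
      obtain ⟨B, hB, hB1⟩ := hA1
      refine hB1 ((Subgroup.eq_bot_iff_forall _).2 fun x hx => ?_)
      have : x ∈ Subgroup.closure S := Subgroup.subset_closure ⟨B, hB, hx⟩
      rwa [hbot, Subgroup.mem_bot] at this

include hF hNT hcent hmin hmax htr hs in
/-- A nonabelian minimal normal subgroup of a primitive group with all nontrivial subdegrees
equal is simple or regular. -/
theorem inf_stabilizer_eq_bot [Finite Ω] [FaithfulSMul G Ω]
    (hNα : ¬ N ≤ MulAction.stabilizer G α) : N ⊓ MulAction.stabilizer G α = ⊥ := by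
  by_contra hreg
  obtain ⟨p, hp, hpn, A, hA, a, ha, ha1, hap, haα⟩ :=
    exists_prime_order_mem_stabilizer hF hcent htr hs hreg
  have hself : ∀ A ∈ 𝒯, ∀ a ∈ A, (∀ x ∈ A ⊓ MulAction.stabilizer G α,
      a * x * a⁻¹ ∈ A ⊓ MulAction.stabilizer G α) → a ∈ MulAction.stabilizer G α :=
    fun B hB b hb hbB => mem_stabilizer_of_normalizes hF hmin hmax hNα
      ⟨A, hA, fun h => ha1 (by
        have : a ∈ A ⊓ MulAction.stabilizer G α := ⟨ha, haα⟩
        rwa [h, Subgroup.mem_bot] at this)⟩ hB hb hbB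
  have hproj : ∀ A ∈ 𝒯, ∀ a ∈ A, ∀ c, (∀ b ∈ A, c * b = b * c) →
      a * c ∈ N ⊓ MulAction.stabilizer G α → a ∈ N ⊓ MulAction.stabilizer G α := by
    intro A hA a ha c hc hac
    refine ⟨hF.le A hA ha, hself A hA a ha fun x hx => ?_⟩
    have : a * x * a⁻¹ = a * c * x * (a * c)⁻¹ := by
      rw [mul_assoc a c, hc x hx.1]
      group
    rw [this]
    exact Subgroup.mem_inf.2
      ⟨hF.normalized A hA _ hac.1 x hx.1, mul_mem (mul_mem hac.2 hx.2) (inv_mem hac.2)⟩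
  have hnle : ∀ A ∈ 𝒯, ¬ A ≤ MulAction.stabilizer G α := by
    intro A hA hle
    refine hNα (hF.generate _ fun B hB => ?_)
    obtain ⟨h, hh, rfl⟩ := hF.exists_stabilizer_conj_eq htr hA hB
    intro x hx
    rw [IsFactorFamily.mem_conj_iff] at hx
    have := mul_mem (mul_mem hh (hle hx)) (inv_mem hh)
    group at this
    exact this
  have hinv : ∀ l ∈ A ⊓ MulAction.stabilizer G α, l ^ 2 = 1 := by
    obtain ⟨B, hB, hBA⟩ := hF.exists_ne hNT hA
    obtain ⟨t, ht, htα⟩ := Set.not_subset.1 (hnle B hB)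
    intro l hl
    have hmoved : ∀ z ∈ A, (z⁻¹ * l ^ 2 * z) ∈ MulAction.stabilizer G α := by
      intro z hz
      by_cases hzα : z ∈ MulAction.stabilizer G α
      · exact mul_mem (mul_mem (inv_mem hzα) (pow_mem hl.2 2)) hzα
      have htN := hF.le B hB ht
      have hzN := hF.le A hA hz
      have htK : t ∉ N ⊓ MulAction.stabilizer G α := fun h => htα h.2
      have hzK : z ∉ N ⊓ MulAction.stabilizer G α := fun h => hzα h.2
      have htz : t * z = z * t := hF.commute B hB A hA hBA t ht z hz
      have htzα : (t * z) • α ≠ α := fun h => htK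
        (hproj B hB t ht z (fun b hb => (hF.commute B hB A hA hBA b hb z hz).symm)
          ⟨mul_mem htN hzN, h⟩)
      let U := MulAction.stabilizer G (t • α) ⊓ MulAction.stabilizer G α
      let V := MulAction.stabilizer G ((t * z) • α) ⊓ MulAction.stabilizer G α
      let W := MulAction.stabilizer G (z • α) ⊓ MulAction.stabilizer G α
      have hUV : Nat.card U = Nat.card V := by
        have h1 := Subgroup.card_inf_mul_relIndex (MulAction.stabilizer G (t • α))
          (MulAction.stabilizer G α)
        have h2 := Subgroup.card_inf_mul_relIndex (MulAction.stabilizer G ((t * z) • α))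
          (MulAction.stabilizer G α)
        rw [hs _ htα] at h1
        rw [hs _ htzα, ← h1] at h2
        have hpos : 0 < s := by
          rw [← hs _ htα]
          exact Nat.pos_of_ne_zero Subgroup.index_ne_zero_of_finite
        exact (Nat.eq_of_mul_eq_mul_right hpos h2).symm
      have hmem : ∀ x ∈ N, ∀ h ∈ MulAction.stabilizer G α,
          (h ∈ MulAction.stabilizer G (x • α) ↔
            x⁻¹ * (h * x * h⁻¹) ∈ N ⊓ MulAction.stabilizer G α) := fun x hx h hh =>
        smul_smul_eq_iff_of_mem_stabilizer hh hx
      have hDV : U ⊓ W ≤ V := by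
        intro h hh
        refine Subgroup.mem_inf.2 ⟨?_, hh.1.2⟩
        have h1 := hF.conj_eq_of_fixes hproj hB ht htK ((hmem t htN h hh.1.2).1 hh.1.1)
        have ht' := IsFactorFamily.conj_apply_mem h ht
        rw [h1] at ht'
        rw [hmem _ (mul_mem htN hzN) h hh.1.2]
        have hsplit : (t * z)⁻¹ * (h * (t * z) * h⁻¹) =
            (t⁻¹ * (h * t * h⁻¹)) * (z⁻¹ * (h * z * h⁻¹)) := by
          have := hF.commute B hB A hA hBA _ (mul_mem (inv_mem ht) ht') z⁻¹ (inv_mem hz)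
          rw [← mul_assoc (t⁻¹ * _), this]
          group
        rw [hsplit]
        exact mul_mem ((hmem t htN h hh.1.2).1 hh.1.1) ((hmem z hzN h hh.1.2).1 hh.2.1)
      have hcase : ∀ h ∈ V, h ∉ U ⊓ W → MulAut.conj h • A = B ∧ MulAut.conj h • B = A := by
        intro h hh hD
        have hfix := (hmem _ (mul_mem htN hzN) h hh.2).1 hh.1
        constructor
        · rcases hF.fixes_or_swaps hproj hB hA hBA ht htK hz hfix with ⟨-, h1, h2⟩ | ⟨h1, -⟩
          · exact absurd ⟨⟨(hmem t htN h hh.2).2 h1, hh.2⟩, (hmem z hzN h hh.2).2 h2, hh.2⟩ hD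
          · exact h1
        · rw [htz] at hfix
          rcases hF.fixes_or_swaps hproj hA hB hBA.symm hz hzK ht hfix with ⟨-, h2, h1⟩ | ⟨h1, -⟩
          · exact absurd ⟨⟨(hmem t htN h hh.2).2 h1, hh.2⟩, (hmem z hzN h hh.2).2 h2, hh.2⟩ hD
          · exact h1
      have hprod : ∀ x ∈ V, x ∉ U ⊓ W → ∀ y ∈ V, y ∉ U ⊓ W → y * x ∈ U ⊓ W := by
        intro x hx hxD y hy hyD
        by_contra hxy
        have h1 := (hcase _ (mul_mem hy hx) hxy).1
        rw [map_mul, mul_smul, (hcase x hx hxD).1, (hcase y hy hyD).2] at h1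
        exact hBA h1.symm
      have hlU : l ∈ U := by
        refine Subgroup.mem_inf.2 ⟨?_, hl.2⟩
        rw [hmem t htN l hl.2, ← hF.commute B hB A hA hBA t ht l hl.1]
        simp [one_mem]
      have hl2 : l ^ 2 ∈ MulAction.stabilizer G (z • α) :=
        (Subgroup.sq_mem_of_card_eq (inf_le_left : U ⊓ W ≤ U) hDV hUV hprod hlU).2.1
      rw [MulAction.mem_stabilizer_iff] at hl2 ⊢
      rw [mul_smul, mul_smul, hl2, inv_smul_smul]
    let C : Subgroup G := Subgroup.closure {x | ∃ z ∈ A, x = z⁻¹ * l ^ 2 * z}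
    have hCA : C ≤ A := by
      rw [Subgroup.closure_le]
      rintro _ ⟨z, hz, rfl⟩
      exact mul_mem (mul_mem (inv_mem hz) (pow_mem hl.1 2)) hz
    have hCα : C ≤ MulAction.stabilizer G α := by
      rw [Subgroup.closure_le]
      rintro _ ⟨z, hz, rfl⟩
      exact hmoved z hz
    by_contra hl2
    have hlC : l ^ 2 ∈ C := Subgroup.subset_closure ⟨1, one_mem A, by simp⟩
    have hCA' : C = A := by
      refine hF.minimal A hA C hCA (fun h => hl2 (by rwa [h, Subgroup.mem_bot] at hlC))
        (hF.normalized_of_normalized hA hCA fun b hb => ?_)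
      suffices hle : C ≤ C.comap (MulAut.conj b).toMonoidHom from fun x hx => hle hx
      rw [Subgroup.closure_le]
      rintro _ ⟨z, hz, rfl⟩
      refine Subgroup.subset_closure ⟨z * b⁻¹, mul_mem hz (inv_mem hb), ?_⟩
      simp [mul_assoc]
    exact hnle A hA (hCA' ▸ hCα)
  have hp2 : p = 2 := by
    rw [← orderOf_eq_prime (hp := ⟨hp⟩) hap ha1]
    exact orderOf_eq_prime (hinv a ⟨ha, haα⟩) ha1
  subst hp2
  let L : Subgroup A := (MulAction.stabilizer G α).subgroupOf A
  have hL : IsPGroup 2 L := fun x => ⟨1, by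
    rw [pow_one]
    exact Subtype.ext (Subtype.ext (hinv _ ⟨x.1.2, x.2⟩))⟩
  obtain ⟨Q, hLQ⟩ := hL.exists_le_sylow
  have hQL : (Q : Subgroup A) = L := by
    symm
    refine Subgroup.eq_of_le_of_card_ge hLQ ?_
    obtain ⟨n, hn, hconj⟩ := exists_conj_mem_stabilizer (α := α) hpn htr
      (Q.isPGroup'.map A.subtype)
    have hmem : ∀ x : Q, n⁻¹ * (x : A) * n ∈ A := fun x => by
      simpa using hF.normalized A hA n⁻¹ (inv_mem hn) _ (x : A).2
    refine Nat.card_le_card_of_injective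
      (fun x : Q => (⟨⟨n⁻¹ * (x : A) * n, hmem x⟩, hconj _ ⟨x, x.2, rfl⟩⟩ : L)) ?_
    intro x y hxy
    have : n⁻¹ * (x : A) * n = n⁻¹ * (y : A) * n :=
      congrArg (fun z : L => ((z : A) : G)) hxy
    exact Subtype.ext (Subtype.ext (mul_left_cancel (mul_right_cancel this)))
  have hsimple : ∀ M : Subgroup A, M.Normal → M = ⊥ ∨ M = ⊤ := by
    intro M hM
    by_cases hM1 : M = ⊥
    · exact Or.inl hM1
    right
    have hMA := Subgroup.map_subtype_le M
    have := hF.minimal A hA _ hMA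
      (fun h => hM1 ((Subgroup.map_eq_bot_iff_of_injective _ A.subtype_injective).1 h))
      (hF.normalized_of_normalized hA hMA ?_)
    · rw [eq_top_iff]
      intro x _
      have hx : (x : G) ∈ M.map A.subtype := by
        rw [this]
        exact x.2
      obtain ⟨y, hy, hyx⟩ := hx
      rwa [← A.subtype_injective hyx]
    · rintro b hb _ ⟨x, hx, rfl⟩
      exact ⟨_, hM.conj_mem x hx ⟨b, hb⟩, rfl⟩
  have : Fact (Nat.Prime 2) := ⟨hp⟩
  have hQα : ∀ x ∈ Q, (x : G) ∈ MulAction.stabilizer G α := fun x hx => by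
    have : x ∈ L := hQL ▸ hx
    exact this
  have hsq : ∀ x ∈ Q, x * x = 1 := fun x hx => Subtype.ext (by
    have := hinv x ⟨x.2, hQα x hx⟩
    rwa [pow_two] at this)
  rcases Q.eq_bot_or_eq_top_of_self_normalizing hsimple (fun x hx y hy => by
      have h1 := hsq x hx
      have h2 := hsq y hy
      have h3 := hsq _ (mul_mem hx hy)
      calc x * y = (x * y)⁻¹ := eq_inv_of_mul_eq_one_left h3
        _ = y * x := by
          rw [mul_inv_rev, ← eq_inv_of_mul_eq_one_left h1, ← eq_inv_of_mul_eq_one_left h2])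
    (fun x hx => by
      have hx' : x ∈ Subgroup.normalizer ((Q : Subgroup A) : Set A) := hx
      rw [hQL, Subgroup.mem_normalizer_iff] at hx'
      have : x ∈ L := hself A hA x x.2 fun y hy =>
        Subgroup.mem_inf.2
          ⟨mul_mem (mul_mem x.2 hy.1) (inv_mem x.2), (hx' ⟨y, hy.1⟩).1 hy.2⟩
      change x ∈ (Q : Subgroup A)
      rwa [hQL]) with h | h
  · have haQ : (⟨a, ha⟩ : A) ∈ (Q : Subgroup A) := by
      rw [hQL]
      exact haα
    rw [h, Subgroup.mem_bot] at haQ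
    exact ha1 (congrArg Subtype.val haQ)
  · refine hnle A hA fun x hx => hQα ⟨x, hx⟩ ?_
    change _ ∈ (Q : Subgroup A)
    rw [h]
    exact Subgroup.mem_top _

end Primitive

theorem Subgroup.relIndex_eq_of_mul_mem {G : Type*} [Group G] {A B Z : Subgroup G}
    (hAB : ∀ a ∈ A, ∃ z ∈ Z, a * z ∈ B) (hBA : ∀ b ∈ B, ∃ z ∈ Z, b * z ∈ A) :
    Z.relIndex A = Z.relIndex B := by
  have key : ∀ {A B : Subgroup G}, (∀ a ∈ A, ∃ z ∈ Z, a * z ∈ B) →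
      MulAction.orbit A ((1 : G) : G ⧸ Z) ⊆ MulAction.orbit B ((1 : G) : G ⧸ Z) := by
    rintro A B h _ ⟨a, rfl⟩
    obtain ⟨z, hz, hb⟩ := h a a.2
    refine ⟨⟨a * z, hb⟩, ?_⟩
    change ((a * z * 1 : G) : G ⧸ Z) = ((a * 1 : G) : G ⧸ Z)
    rw [QuotientGroup.eq]
    simpa using hz
  have hZ : MulAction.stabilizer G ((1 : G) : G ⧸ Z) = Z := MulAction.stabilizer_quotient Z
  have hcard : ∀ A : Subgroup G, Nat.card (MulAction.orbit A ((1 : G) : G ⧸ Z)) = Z.relIndex A :=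
    fun A => (card_orbit_eq_relIndex A _).trans (by rw [hZ])
  rw [← hcard A, ← hcard B, (key hAB).antisymm (key hBA)]

section Primitive

variable {G Ω : Type*} [Group G] [MulAction G Ω] [FaithfulSMul G Ω] {α : Ω} {s : ℕ}
  {N : Subgroup G}

/-- A subgroup commuting with a transitive subgroup is semiregular. -/
theorem inf_stabilizer_eq_bot_of_commute {C : Subgroup G} (hC : ∀ β : Ω, ∃ c ∈ C, c • α = β)
    (hNC : ∀ c ∈ C, ∀ n ∈ N, c * n = n * c) : N ⊓ MulAction.stabilizer G α = ⊥ := by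
  refine (Subgroup.eq_bot_iff_forall _).2 fun x hx => ?_
  refine FaithfulSMul.eq_of_smul_eq_smul (α := Ω) fun β => ?_
  obtain ⟨c, hc, rfl⟩ := hC β
  rw [smul_smul, ← hNC c hc x hx.1, mul_smul, one_smul]
  exact congrArg _ hx.2

/-- If two commuting normal subgroups of a group with all nontrivial subdegrees equal are
transitive, then they are abelian. -/
theorem commute_of_transitive_centralizer [Finite G] [Finite Ω] [N.Normal] {C : Subgroup G}
    [C.Normal] (hN : ∀ β : Ω, ∃ n ∈ N, n • α = β) (hC : ∀ β : Ω, ∃ c ∈ C, c • α = β)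
    (hNC : ∀ c ∈ C, ∀ n ∈ N, c * n = n * c)
    (hs : ∀ β, β ≠ α → (MulAction.stabilizer G β).relIndex (MulAction.stabilizer G α) = s) :
    ∀ x ∈ N, ∀ y ∈ N, x * y = y * x := by
  have hreg := inf_stabilizer_eq_bot_of_commute hC hNC
  have hcard : Nat.card N = Nat.card Ω := by
    have h1 := card_orbit_eq_relIndex N α
    have h2 : MulAction.orbit N α = Set.univ := Set.eq_univ_of_forall fun β => by
      obtain ⟨n, hn, rfl⟩ := hN β
      exact ⟨⟨n, hn⟩, rfl⟩
    rw [h2, Nat.card_univ, ← Subgroup.inf_relIndex_right, inf_comm, hreg,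
      Subgroup.relIndex_bot_left] at h1
    exact h1.symm
  intro x hx y hy
  by_cases hxα : x • α = α
  · have : x ∈ N ⊓ MulAction.stabilizer G α := ⟨hx, hxα⟩
    rw [hreg, Subgroup.mem_bot] at this
    rw [this, one_mul, mul_one]
  let Z := Subgroup.centralizer {x}
  let K := (N ⊔ C) ⊓ MulAction.stabilizer G α
  have hCZ : C ≤ Z := fun c hc => Subgroup.mem_centralizer_singleton_iff.2 (hNC c hc x hx)
  have hK : (MulAction.stabilizer G (x • α)).relIndex K = Z.relIndex K := by
    rw [← Subgroup.inf_relIndex_right, ← Subgroup.inf_relIndex_right Z]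
    congr 1
    ext k
    simp only [Subgroup.mem_inf]
    refine and_congr_left fun hk => ?_
    rw [MulAction.mem_stabilizer_iff, smul_smul_eq_iff_of_mem_stabilizer hk.2 hx, hreg, Subgroup.mem_bot, inv_mul_eq_one,
      eq_mul_inv_iff_mul_eq, Subgroup.mem_centralizer_singleton_iff, eq_comm]
  have hNK : Z.relIndex K = Z.relIndex N := by
    refine Subgroup.relIndex_eq_of_mul_mem (fun k hk => ?_) fun n hn => ?_
    · obtain ⟨n, hn, c, hc, rfl⟩ := Subgroup.mem_sup_of_normal_left.1 (Subgroup.mem_inf.1 hk).1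
      exact ⟨c⁻¹, hCZ (inv_mem hc), by simpa using hn⟩
    · obtain ⟨c, hc, hcα⟩ := hC (n⁻¹ • α)
      refine ⟨c, hCZ hc, Subgroup.mem_inf.2 ⟨Subgroup.mul_mem_sup hn hc, ?_⟩⟩
      rw [MulAction.mem_stabilizer_iff, mul_smul, hcα, smul_inv_smul]
  have hcop := coprime_relIndex_of_normalizes (K := K) hs inf_le_right (fun h hh k hk =>
    Subgroup.mem_inf.2 ⟨Subgroup.Normal.conj_mem inferInstance k hk.1 h,
      mul_mem (mul_mem hh hk.2) (inv_mem hh)⟩) hxα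
  rw [hK, hNK, ← hcard] at hcop
  have h1 := Nat.eq_one_of_dvd_coprimes hcop dvd_rfl (Subgroup.relIndex_dvd_card Z N)
  exact (Subgroup.mem_centralizer_singleton_iff.1 (Subgroup.relIndex_eq_one.1 h1 hy)).symm

end Primitive

/-- An abelian minimal normal subgroup of a finite group is elementary abelian. -/
theorem exists_prime_pow_eq_one_of_minimal {G : Type*} [Group G] [Finite G] {N : Subgroup G}
    [N.Normal] (hN : N ≠ ⊥) (hmin : ∀ M : Subgroup G, M.Normal → M ≠ ⊥ → M ≤ N → M = N)
    (hcomm : ∀ x ∈ N, ∀ y ∈ N, x * y = y * x) : ∃ p : ℕ, p.Prime ∧ ∀ x ∈ N, x ^ p = 1 := by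
  obtain ⟨p, hp, hpN⟩ := Nat.exists_prime_and_dvd fun h => hN (Subgroup.card_eq_one.1 h)
  have : Fact p.Prime := ⟨hp⟩
  obtain ⟨x, hx⟩ := exists_prime_orderOf_dvd_card' p hpN
  let M : Subgroup G :=
    { carrier := {x | x ∈ N ∧ x ^ p = 1}
      one_mem' := ⟨one_mem N, one_pow p⟩
      mul_mem' := fun {a b} ha hb => ⟨mul_mem ha.1 hb.1, by
        rw [(show Commute a b from hcomm a ha.1 b hb.1).mul_pow, ha.2, hb.2, one_mul]⟩
      inv_mem' := fun {a} ha => ⟨inv_mem ha.1, by rw [inv_pow, ha.2, inv_one]⟩ }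
  have hM : M.Normal := ⟨fun a ha g => ⟨Subgroup.Normal.conj_mem ‹_› a ha.1 g, by
    rw [conj_pow, ha.2, mul_one, mul_inv_cancel]⟩⟩
  have hxp : (x : G) ^ p = 1 := by rw [← hx, ← Subgroup.orderOf_coe, pow_orderOf_eq_one]
  have hMN : M = N := by
    refine hmin M hM (fun h => ?_) fun x hx => hx.1
    have hxM : (x : G) ∈ M := ⟨x.2, hxp⟩
    rw [h, Subgroup.mem_bot] at hxM
    rw [← Subgroup.orderOf_coe, hxM, orderOf_one] at hx
    exact hp.one_lt.ne hx
  exact ⟨p, hp, fun y hy => (show y ∈ M by rwa [hMN]).2⟩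

theorem isSimpleGroup_of_mem_factorFamily {G : Type*} [Group G] {N : Subgroup G}
    {𝒯 : Set (Subgroup G)} (hF : IsFactorFamily N 𝒯) (hN : N ∈ 𝒯) : IsSimpleGroup N := by
  have : Nontrivial N := (Subgroup.nontrivial_iff_ne_bot N).2 (hF.ne_bot N hN)
  refine ⟨fun M hM => or_iff_not_imp_left.2 fun hM1 => ?_⟩
  have h := hF.minimal N hN _ (Subgroup.map_subtype_le M)
    (fun h => hM1 ((Subgroup.map_eq_bot_iff_of_injective _ N.subtype_injective).1 h)) (by
      rintro b hb _ ⟨x, hx, rfl⟩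
      exact ⟨_, hM.conj_mem x hx ⟨b, hb⟩, rfl⟩)
  rw [eq_top_iff]
  intro x _
  have hx : (x : G) ∈ M.map N.subtype := by
    rw [h]
    exact x.2
  obtain ⟨y, hy, hyx⟩ := hx
  rwa [← N.subtype_injective hyx]

theorem exists_minimal_normal (G : Type*) [Group G] [Finite G] [Nontrivial G] :
    ∃ N : Subgroup G, N.Normal ∧ N ≠ ⊥ ∧
      ∀ M : Subgroup G, M.Normal → M ≠ ⊥ → M ≤ N → M = N := by
  obtain ⟨N, ⟨hN, hN1⟩, hmin⟩ :=
    (Set.toFinite {M : Subgroup G | M.Normal ∧ M ≠ ⊥}).exists_minimal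
      ⟨⊤, inferInstance, top_ne_bot⟩
  exact ⟨N, hN, hN1, fun M hM hM1 hle => le_antisymm hle (hmin ⟨hM, hM1⟩ hle)⟩

theorem le_of_minimal_of_centralizer_eq_bot {G : Type*} [Group G] {N M : Subgroup G}
    (hN : N.Normal) (hmin : ∀ M : Subgroup G, M.Normal → M ≠ ⊥ → M ≤ N → M = N)
    (hcent : ∀ x : G, (∀ n ∈ N, x * n = n * x) → x = 1) (hM : M.Normal) (hM1 : M ≠ ⊥) :
    N ≤ M := by
  by_cases h : M ⊓ N = ⊥
  · refine absurd ((Subgroup.eq_bot_iff_forall M).2 fun x hx => hcent x fun n hn => ?_) hM1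
    exact Subgroup.commute_of_normal_of_disjoint M N hM hN (disjoint_iff.2 h) x n hx hn
  · rw [← hmin (M ⊓ N) inferInstance h inf_le_right]
    exact inf_le_left

end

/-- Theorem 1.1: every finite primitive `3/2`-transitive permutation group is either
affine (it has an elementary abelian regular normal subgroup) or almost simple (it
has a unique minimal normal subgroup which is nonabelian simple). -/
theorem stmt14 {G Ω : Type*} [Group G] [Finite G] [Finite Ω] [MulAction G Ω]
    [FaithfulSMul G Ω] (hprim : IsPrimitiveAction G Ω)
    (h32 : IsThreeHalvesTransitive G Ω) :
    (∃ N : Subgroup G, N.Normal ∧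
      (∃ p : ℕ, p.Prime ∧ ∀ x ∈ N, x ^ p = 1) ∧
      (∀ x ∈ N, ∀ y ∈ N, x * y = y * x) ∧
      MulAction.IsPretransitive N Ω ∧
      (∀ α : Ω, MulAction.stabilizer N α = ⊥)) ∨
    (∃ N : Subgroup G, N.Normal ∧ IsSimpleGroup N ∧
      (∃ a b : N, a * b ≠ b * a) ∧
      (∀ M : Subgroup G, M.Normal → M ≠ ⊥ → N ≤ M)) := by
  have hpp : MulAction.IsPreprimitive G Ω :=
    { hprim.1 with isTrivialBlock_of_isBlock := fun {B} hB => hprim.2 B hB }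
  rcases subsingleton_or_nontrivial Ω with hΩ | hΩ
  · have hG : ∀ x : G, x = 1 := fun x =>
      FaithfulSMul.eq_of_smul_eq_smul (α := Ω) fun β => Subsingleton.elim _ _
    refine Or.inl ⟨⊥, inferInstance, ⟨2, Nat.prime_two, fun x _ => hG _⟩,
      fun x _ y _ => (hG _).trans (hG _).symm, ⟨fun β γ => ⟨1, Subsingleton.elim _ _⟩⟩,
      fun β => Subsingleton.elim _ _⟩
  obtain ⟨α, β, hαβ⟩ := exists_pair_ne Ω
  have hmax : ∀ X : Subgroup G, MulAction.stabilizer G α ≤ X →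
      X = MulAction.stabilizer G α ∨ X = ⊤ := fun X hX => by
    have := (MulAction.isCoatom_stabilizer_iff_preprimitive G α).2 hpp
    exact (this.le_iff.1 hX).symm
  have htrans : ∀ M : Subgroup G, M.Normal → M ≠ ⊥ → MulAction.IsPretransitive M Ω := by
    intro M hM hM1
    refine MulAction.IsQuasiPreprimitive.isPretransitive_of_normal (G := G) fun h => hM1 ?_
    refine (Subgroup.eq_bot_iff_forall M).2 fun x hx => ?_
    refine FaithfulSMul.eq_of_smul_eq_smul (α := Ω) fun γ => ?_
    rw [one_smul]
    exact (h.symm ▸ Set.mem_univ γ : γ ∈ MulAction.fixedPoints M Ω) ⟨x, hx⟩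
  have htr' : ∀ M : Subgroup G, M.Normal → M ≠ ⊥ → ∀ γ : Ω, ∃ m ∈ M, m • α = γ := by
    intro M hM hM1 γ
    obtain ⟨m, hm⟩ := (htrans M hM hM1).exists_smul_eq α γ
    exact ⟨m, m.2, hm⟩
  obtain ⟨s, -, hs'⟩ := h32.2 α
  have hs : ∀ γ, γ ≠ α →
      (MulAction.stabilizer G γ).relIndex (MulAction.stabilizer G α) = s := fun γ hγ =>
    (card_orbit_eq_relIndex _ γ).symm.trans (hs' γ hγ)
  have : Nontrivial G := by
    obtain ⟨g, hg⟩ := hprim.1.exists_smul_eq α β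
    exact ⟨g, 1, fun h => hαβ (by rw [← hg, h, one_smul])⟩
  obtain ⟨N, hN, hN1, hmin⟩ := exists_minimal_normal G
  have htr := htr' N hN hN1
  by_cases hcomm : ∀ x ∈ N, ∀ y ∈ N, x * y = y * x
  · refine Or.inl ⟨N, hN, exists_prime_pow_eq_one_of_minimal hN1 hmin hcomm, hcomm,
      htrans N hN hN1, fun γ => (Subgroup.eq_bot_iff_forall _).2 fun x hx => ?_⟩
    have htrγ : ∀ δ : Ω, ∃ n ∈ N, n • γ = δ := fun δ => by
      obtain ⟨n, hn⟩ := (htrans N hN hN1).exists_smul_eq γ δ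
      exact ⟨n, n.2, hn⟩
    have hreg := inf_stabilizer_eq_bot_of_commute htrγ fun c hc n hn => hcomm c hc n hn
    have hxN : (x : G) ∈ N ⊓ MulAction.stabilizer G γ := ⟨x.2, hx⟩
    rw [hreg, Subgroup.mem_bot] at hxN
    exact Subtype.ext hxN
  right
  have hcent : ∀ x : G, (∀ n ∈ N, x * n = n * x) → x = 1 := by
    by_contra! hne
    obtain ⟨c, hc, hc1⟩ := hne
    have hcC : c ∈ Subgroup.centralizer (N : Set G) :=
      Subgroup.mem_centralizer_iff.2 fun n hn => (hc n hn).symm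
    have hC1 : Subgroup.centralizer (N : Set G) ≠ ⊥ := fun h => hc1 (by
      rwa [h, Subgroup.mem_bot] at hcC)
    exact hcomm (commute_of_transitive_centralizer htr (htr' _ inferInstance hC1)
      (fun c hc n hn => (Subgroup.mem_centralizer_iff.1 hc n hn).symm) hs)
  obtain ⟨𝒯, hF⟩ := IsFactorFamily.exists_of_minimal hN1 hmin hcent
  have hNT : N ∈ 𝒯 := by
    by_contra hNT
    have hNα : ¬ N ≤ MulAction.stabilizer G α := fun h => by
      obtain ⟨n, hn, hnβ⟩ := htr β
      exact hαβ ((MulAction.mem_stabilizer_iff.1 (h hn)).symm.trans hnβ)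
    have hreg := inf_stabilizer_eq_bot hF hNT hcent hmin hmax htr hs hNα
    exact false_of_fixedPointFree hcent hmin hmax hN1 hreg fun x hx hx1 h hh hhx =>
      eq_one_of_commute_of_regular hF hNT hcent hreg hs hx hx1 hh hhx
  refine ⟨N, hN, isSimpleGroup_of_mem_factorFamily hF hNT, ?_, fun M hM hM1 =>
    le_of_minimal_of_centralizer_eq_bot hN hmin hcent hM hM1⟩
  push Not at hcomm
  obtain ⟨a, ha, b, hb, hab⟩ := hcomm
  exact ⟨⟨a, ha⟩, ⟨b, hb⟩, fun h => hab (congrArg Subtype.val h)⟩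
end
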